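/- arXiv:2312.12690 — 3 statements merged into one kernel-verified Lean document; each statement's English description precedes it below -/
import Mathlib

section
/- Let m ≥ 0, q ≥ 0, L ≥ 0 and n be integers with n ≥ m+q+2, and let x > 0 be a real number with g_j^{(n,L)}(x) ≠ 0 for all m ≤ j ≤ m+q+1. Then ∑_{j=m}^{m+q} (Γ(n+L+1)/(Γ(j+L+2)·Γ(n−j−1))) · x^j/(g_{j+1}^{(n,L)}(x)·g_j^{(n,L)}(x)) = (Γ(n+L+1)/(Γ(L+q+m+2)·Γ(n−m−1))) · (x^m/(g_{m+q+1}^{(n,L)}(x)·g_m^{(n,L)}(x))) · [ ∑_{k=0}^{q} ((q+1−k)·Γ(n−m)·Γ(L+q+m+2)/(Γ(n−m−k)·Γ(L+k+m+2)))·x^k − (L+m+1)·∑_{k=0}^{q} ((q−k)·Γ(n−m−1)·Γ(L+q+m+2)/(Γ(n−m−k−1)·Γ(L+k+m+3)))·x^k ]. -/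
open Finset

noncomputable section

/-- `g_m^{(n,L)}(x)`. -/
def gP (n L m : ℕ) (x : ℝ) : ℝ :=
  ((x - (L : ℝ) / n) / x) *
      ∑ k ∈ Finset.range (m + 1), ((m : ℝ) + 1 - k) * (Nat.choose (L + n) (L + k) : ℝ) * x ^ k
    + ((L : ℝ) * ((m : ℝ) + 1) / ((n : ℝ) * x)) * (Nat.choose (L + n) L : ℝ)

/-- The absorption identity for the coefficients of `gP`. -/
lemma choose_succ_mul_real (n L k : ℕ) :
    ((L : ℝ) + k + 1) * ((L + n).choose (L + k + 1) : ℝ)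
      = ((n : ℝ) - k) * ((L + n).choose (L + k) : ℝ) := by
  have h := Nat.choose_succ_right_eq (L + n) (L + k)
  rcases le_or_gt k n with hk | hk
  · have h' : ((L + n).choose (L + k + 1) : ℝ) * ((L + k + 1 : ℕ) : ℝ)
        = ((L + n).choose (L + k) : ℝ) * ((L + n - (L + k) : ℕ) : ℝ) := by
      exact_mod_cast h
    rw [Nat.cast_sub (by omega)] at h'
    push_cast at h'
    linarith
  · rw [Nat.choose_eq_zero_of_lt (by omega : L + n < L + k + 1),
      Nat.choose_eq_zero_of_lt (by omega : L + n < L + k)]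
    simp

lemma gP_zero {n L : ℕ} (hn : n ≠ 0) {x : ℝ} (hx : x ≠ 0) :
    gP n L 0 x = ((L + n).choose L : ℝ) := by
  have hn' : (n : ℝ) ≠ 0 := Nat.cast_ne_zero.mpr hn
  simp [gP]
  field_simp
  ring

lemma gP_succ_sub (n L i : ℕ) (x : ℝ) :
    gP n L (i + 1) x - gP n L i x
      = ((x - (L : ℝ) / n) / x) *
          ∑ k ∈ Finset.range (i + 2), ((L + n).choose (L + k) : ℝ) * x ^ k
        + ((L : ℝ) / ((n : ℝ) * x)) * ((L + n).choose L : ℝ) := by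
  have h : ∑ k ∈ Finset.range (i + 2),
        (((i + 1 : ℕ) : ℝ) + 1 - k) * ((L + n).choose (L + k) : ℝ) * x ^ k
      = ∑ k ∈ Finset.range (i + 1), ((i : ℝ) + 1 - k) * ((L + n).choose (L + k) : ℝ) * x ^ k
        + ∑ k ∈ Finset.range (i + 2), ((L + n).choose (L + k) : ℝ) * x ^ k := by
    have h' : ∑ k ∈ Finset.range (i + 1),
          (((i + 1 : ℕ) : ℝ) + 1 - k) * ((L + n).choose (L + k) : ℝ) * x ^ k
        = ∑ k ∈ Finset.range (i + 1), ((i : ℝ) + 1 - k) * ((L + n).choose (L + k) : ℝ) * x ^ k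
          + ∑ k ∈ Finset.range (i + 1), ((L + n).choose (L + k) : ℝ) * x ^ k := by
      rw [← Finset.sum_add_distrib]
      refine Finset.sum_congr rfl fun k _ => ?_
      push_cast
      ring
    rw [Finset.sum_range_succ, Finset.sum_range_succ _ (i + 1), h']
    push_cast
    ring
  unfold gP
  rw [h]
  push_cast
  ring

lemma gP_one {n L : ℕ} (hn : n ≠ 0) {x : ℝ} (hx : x ≠ 0) :
    ((L : ℝ) + 1) * gP n L 1 x = ((L : ℝ) + 2 + n * x) * gP n L 0 x := by
  have hn' : (n : ℝ) ≠ 0 := Nat.cast_ne_zero.mpr hn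
  have h := choose_succ_mul_real n L 0
  have h1 := gP_succ_sub n L 0 x
  rw [gP_zero hn hx] at h1 ⊢
  simp [Finset.sum_range_succ] at h h1
  rw [eq_add_of_sub_eq h1]
  field_simp
  linear_combination ((n : ℝ) * x - L) * x * h

/-- The three-term recurrence satisfied by `gP`. -/
lemma gP_add_two {n L : ℕ} (hn : n ≠ 0) {x : ℝ} (hx : x ≠ 0) (i : ℕ) :
    ((L : ℝ) + i + 2) * gP n L (i + 2) x
      = ((L : ℝ) + i + 3 + ((n : ℝ) - i - 1) * x) * gP n L (i + 1) x
        - ((n : ℝ) - i - 2) * x * gP n L i x := by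
  have step (j : ℕ) : gP n L (j + 2) x - gP n L (j + 1) x
      = gP n L (j + 1) x - gP n L j x
        + ((x - (L : ℝ) / n) / x) * (((L + n).choose (L + (j + 2)) : ℝ) * x ^ (j + 2)) := by
    rw [gP_succ_sub n L (j + 1), gP_succ_sub n L j, Finset.sum_range_succ _ (j + 2)]
    ring
  induction i with
  | zero =>
    have h1 := choose_succ_mul_real n L 1
    have h2 := gP_one (L := L) hn hx
    have h3 := gP_succ_sub n L 0 x
    have h4 := step 0
    have hn' : (n : ℝ) ≠ 0 := Nat.cast_ne_zero.mpr hn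
    rw [Finset.sum_range_succ, Finset.sum_range_one] at h3
    simp only [Nat.add_assoc, Nat.reduceAdd, Nat.cast_zero, Nat.cast_one, add_zero, zero_add]
      at h1 h2 h3 h4 ⊢
    set a := (x - (L : ℝ) / n) / x with ha
    have e1 : ((L : ℝ) + 2) * (a * (((L + n).choose (L + 2) : ℝ) * x ^ 2))
        = (n - 1) * x * (a * (((L + n).choose (L + 1) : ℝ) * x)) := by
      linear_combination a * x ^ 2 * h1
    have e2 : a * ((L + n).choose L : ℝ) + (L : ℝ) / (n * x) * ((L + n).choose L : ℝ)
        = gP n L 0 x := by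
      rw [gP_zero hn hx, ha]
      field_simp
      ring
    linear_combination ((L : ℝ) + 2) * h4 + e1 + h2 - ((n : ℝ) - 1) * x * h3
      - ((n : ℝ) - 1) * x * e2
  | succ i ih =>
    have h0 := choose_succ_mul_real n L (i + 2)
    have h1 := step i
    have h2 := step (i + 1)
    push_cast at h0 ⊢
    simp only [Nat.add_assoc, Nat.reduceAdd] at h0 h1 h2 ih ⊢
    linear_combination ih + ((L : ℝ) + i + 3) * h2 - ((n : ℝ) - i - 2) * x * h1
      + ((x - (L : ℝ) / n) / x) * x ^ (i + 3) * h0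

/-- The Casoratian of the solutions `q ↦ gP (m + 1 + d) L (m + 1 + q)` and
`q ↦ gP d (L + m + 1) q` of the same three-term recurrence. -/
lemma gP_casoratian (m d L : ℕ) (hd : d ≠ 0) {x : ℝ} (hx : x ≠ 0) (q : ℕ) :
    (d : ℝ) * (gP d (L + m + 1) (q + 1) x * gP (m + 1 + d) L (m + q + 1) x
        - gP d (L + m + 1) q x * gP (m + 1 + d) L (m + q + 2) x)
      = ((L + (m + 1 + d)).choose (L + (m + q + 2)) : ℝ) * ((d : ℝ) - q - 1)
        * x ^ (q + 1) * gP (m + 1 + d) L m x := by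
  have hn : m + 1 + d ≠ 0 := by omega
  induction q with
  | zero =>
    have h1 := gP_one (L := L + m + 1) hd hx
    have h2 := gP_add_two (L := L) hn hx m
    have h3 := choose_succ_mul_real (m + 1 + d) L (m + 1)
    have h4 := gP_zero (L := L + m + 1) hd hx
    rw [show L + m + 1 + d = L + (m + 1 + d) by ring] at h4
    have hpos : ((L : ℝ) + m + 2) ≠ 0 := by positivity
    refine mul_left_cancel₀ hpos ?_
    push_cast at h1 h2 h3 h4 ⊢
    simp only [Nat.add_assoc, Nat.reduceAdd, add_zero] at h1 h2 h3 h4 ⊢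
    set n := m + (1 + d)
    linear_combination (d : ℝ) * gP n L (m + 1) x * h1 - d * gP d (L + (m + 1)) 0 x * h2
      + d * (d - 1) * x * gP n L m x * h4 - (d - 1) * x * gP n L m x * h3
  | succ q ih =>
    have h1 := gP_add_two (L := L + m + 1) hd hx q
    have h2 := gP_add_two (L := L) hn hx (m + q + 1)
    have h3 := choose_succ_mul_real (m + 1 + d) L (m + q + 2)
    have hpos : ((L : ℝ) + m + q + 3) ≠ 0 := by positivity
    refine mul_left_cancel₀ hpos ?_
    rw [show m + (q + 1) + 1 = m + q + 1 + 1 by ring, show m + (q + 1) + 2 = m + q + 1 + 2 by ring]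
    push_cast at h1 h2 h3 ⊢
    simp only [Nat.add_assoc, Nat.reduceAdd] at h1 h2 h3 ih ⊢
    set n := m + (1 + d)
    linear_combination (d : ℝ) * gP n L (m + (q + 2)) x * h1
      - d * gP d (L + (m + 1)) (q + 1) x * h2 + (d - q - 2) * x * ih
      - (d - q - 2) * x ^ (q + 2) * gP n L m x * h3

/-- The partial sums of the Casoratian quotients telescope. -/
lemma sum_choose_div_gP (m d L q : ℕ) (hd : d ≠ 0) {x : ℝ} (hx : x ≠ 0)
    (hg : ∀ j, m ≤ j → j ≤ m + q + 1 → gP (m + 1 + d) L j x ≠ 0) :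
    ∑ j ∈ Finset.Icc m (m + q),
        (((L + (m + 1 + d)).choose (L + (j + 1)) : ℝ) * ((m : ℝ) + d - j)) *
          (x ^ j / (gP (m + 1 + d) L (j + 1) x * gP (m + 1 + d) L j x))
      = x ^ m / (gP (m + 1 + d) L (m + q + 1) x * gP (m + 1 + d) L m x) *
          (d * gP d (L + m + 1) q x) := by
  induction q with
  | zero =>
    rw [gP_zero hd hx, show L + m + 1 + d = L + (m + 1 + d) by ring]
    simp only [add_zero, Finset.Icc_self, Finset.sum_singleton, Nat.add_assoc]
    ring
  | succ q ih =>
    have h0 := hg m le_rfl (by omega)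
    have h1 := hg (m + q + 1) (by omega) (by omega)
    have h2 := hg (m + q + 2) (by omega) (by omega)
    have hc := gP_casoratian m d L hd hx q
    rw [← Nat.add_assoc m q 1, Finset.sum_Icc_succ_top (by omega),
      ih fun j hj hj' => hg j hj (by omega)]
    push_cast
    simp only [Nat.add_assoc, Nat.reduceAdd] at h0 h1 h2 hc ⊢
    field_simp
    linear_combination (-x ^ m) * hc

lemma natCast_mul_gP {n : ℕ} (hn : n ≠ 0) (L q : ℕ) {x : ℝ} (hx : x ≠ 0) :
    (n : ℝ) * gP n L q x
      = ∑ k ∈ Finset.range (q + 1),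
          ((q : ℝ) + 1 - k) * (n * ((L + n).choose (L + k) : ℝ)) * x ^ k
        - L * ∑ k ∈ Finset.range (q + 1),
          ((q : ℝ) - k) * ((L + n).choose (L + k + 1) : ℝ) * x ^ k := by
  have hn' : (n : ℝ) ≠ 0 := Nat.cast_ne_zero.mpr hn
  have h1 : ∑ k ∈ Finset.range (q + 1),
        ((q : ℝ) + 1 - k) * (n * ((L + n).choose (L + k) : ℝ)) * x ^ k
      = n * ∑ k ∈ Finset.range (q + 1),
        ((q : ℝ) + 1 - k) * ((L + n).choose (L + k) : ℝ) * x ^ k := by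
    rw [Finset.mul_sum]
    exact Finset.sum_congr rfl fun k _ => by ring
  have h2 : ∑ k ∈ Finset.range (q + 1),
        ((q : ℝ) + 1 - k) * ((L + n).choose (L + k) : ℝ) * x ^ k
      = x * ∑ k ∈ Finset.range (q + 1),
          ((q : ℝ) - k) * ((L + n).choose (L + k + 1) : ℝ) * x ^ k
        + ((q : ℝ) + 1) * ((L + n).choose L : ℝ) := by
    rw [Finset.sum_range_succ', Finset.sum_range_succ _ q, sub_self, zero_mul, zero_mul,
      add_zero, add_zero, Finset.mul_sum]
    congr 1
    · refine Finset.sum_congr rfl fun k _ => ?_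
      push_cast
      ring_nf
    · simp
  rw [h1]
  unfold gP
  generalize ∑ k ∈ Finset.range (q + 1),
    ((q : ℝ) + 1 - k) * ((L + n).choose (L + k) : ℝ) * x ^ k = F at *
  rw [h2]
  field_simp
  ring

lemma Gamma_natCast_add_one_div (N a b : ℕ) (h : a + b = N) :
    Real.Gamma ((N : ℝ) + 1) / (Real.Gamma ((a : ℝ) + 1) * Real.Gamma ((b : ℝ) + 1))
      = (N.choose a : ℝ) := by
  subst h
  rw [Real.Gamma_nat_eq_factorial, Real.Gamma_nat_eq_factorial, Real.Gamma_nat_eq_factorial,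
    Nat.cast_add_choose]

lemma Gamma_natCast_add_one_div_of_ne_zero (N a b : ℕ) (h : a + b = N) (hb : b ≠ 0) :
    Real.Gamma ((N : ℝ) + 1) / (Real.Gamma ((a : ℝ) + 1) * Real.Gamma (b : ℝ))
      = (N.choose a : ℝ) * b := by
  have hb' : (b : ℝ) ≠ 0 := Nat.cast_ne_zero.mpr hb
  rw [← Gamma_natCast_add_one_div N a b h, Real.Gamma_add_one hb']
  field_simp

/-- Closed form of the partial sum `Φ_{m+q,m}^{(n,L)}(x)`. -/
theorem Phi_partial_closed_form (m q L n : ℕ) (hn : m + q + 2 ≤ n)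
    (x : ℝ) (hx : 0 < x)
    (hg : ∀ j, m ≤ j → j ≤ m + q + 1 → gP n L j x ≠ 0) :
    (∑ j ∈ Finset.Icc m (m + q),
        Real.Gamma ((n : ℝ) + L + 1) /
            (Real.Gamma ((j : ℝ) + L + 2) * Real.Gamma ((n : ℝ) - j - 1)) *
          (x ^ j / (gP n L (j + 1) x * gP n L j x)))
      = Real.Gamma ((n : ℝ) + L + 1) /
          (Real.Gamma ((L : ℝ) + q + m + 2) * Real.Gamma ((n : ℝ) - m - 1)) *
        (x ^ m / (gP n L (m + q + 1) x * gP n L m x)) *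
        ((∑ k ∈ Finset.range (q + 1),
            ((q : ℝ) + 1 - k) * Real.Gamma ((n : ℝ) - m) * Real.Gamma ((L : ℝ) + q + m + 2) /
              (Real.Gamma ((n : ℝ) - m - k) * Real.Gamma ((L : ℝ) + k + m + 2)) * x ^ k)
          - ((L : ℝ) + m + 1) *
            ∑ k ∈ Finset.range (q + 1),
              ((q : ℝ) - k) * Real.Gamma ((n : ℝ) - m - 1) * Real.Gamma ((L : ℝ) + q + m + 2) /
                (Real.Gamma ((n : ℝ) - m - k - 1) * Real.Gamma ((L : ℝ) + k + m + 3)) * x ^ k) := by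
  obtain ⟨d, rfl⟩ : ∃ d, n = m + 1 + d := ⟨n - (m + 1), by omega⟩
  have hqd : q + 1 ≤ d := by omega
  have hd : d ≠ 0 := by omega
  have hd' : (0 : ℝ) < d := Nat.cast_pos.mpr (Nat.pos_of_ne_zero hd)
  have hA : Real.Gamma ((L : ℝ) + q + m + 2) ≠ 0 := (Real.Gamma_pos_of_pos (by positivity)).ne'
  have hGd : Real.Gamma (d : ℝ) ≠ 0 := (Real.Gamma_pos_of_pos hd').ne'
  have eN : ((m + 1 + d : ℕ) : ℝ) + L + 1 = ((L + (m + 1 + d) : ℕ) : ℝ) + 1 := by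
    push_cast
    ring
  have ed : ((m + 1 + d : ℕ) : ℝ) - m - 1 = d := by
    push_cast
    ring
  have ed1 : ((m + 1 + d : ℕ) : ℝ) - m = d + 1 := by
    push_cast
    ring
  rw [ed, ed1, eN]
  have hL : ∀ j ∈ Finset.Icc m (m + q),
      Real.Gamma (((L + (m + 1 + d) : ℕ) : ℝ) + 1) /
          (Real.Gamma ((j : ℝ) + L + 2) * Real.Gamma (((m + 1 + d : ℕ) : ℝ) - j - 1)) *
          (x ^ j / (gP (m + 1 + d) L (j + 1) x * gP (m + 1 + d) L j x))
        = (((L + (m + 1 + d)).choose (L + (j + 1)) : ℝ) * ((m : ℝ) + d - j)) *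
          (x ^ j / (gP (m + 1 + d) L (j + 1) x * gP (m + 1 + d) L j x)) := by
    intro j hj
    rw [Finset.mem_Icc] at hj
    have hb : ((m + d - j : ℕ) : ℝ) = (m : ℝ) + d - j := by
      rw [Nat.cast_sub (by omega)]
      push_cast
      ring
    rw [← hb, ← Gamma_natCast_add_one_div_of_ne_zero (L + (m + 1 + d)) (L + (j + 1)) (m + d - j)
      (by omega) (by omega), hb]
    push_cast
    ring_nf
  have hF : ∀ k ∈ Finset.range (q + 1),
      Real.Gamma (((L + (m + 1 + d) : ℕ) : ℝ) + 1) /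
          (Real.Gamma ((L : ℝ) + q + m + 2) * Real.Gamma (d : ℝ)) *
          (((q : ℝ) + 1 - k) * Real.Gamma ((d : ℝ) + 1) * Real.Gamma ((L : ℝ) + q + m + 2) /
              (Real.Gamma ((d : ℝ) + 1 - k) * Real.Gamma ((L : ℝ) + k + m + 2)) * x ^ k)
        = ((q : ℝ) + 1 - k) * (d * ((L + m + 1 + d).choose (L + m + 1 + k) : ℝ)) * x ^ k := by
    intro k hk
    rw [Finset.mem_range] at hk
    have hb : (d : ℝ) + 1 - k = ((d - k : ℕ) : ℝ) + 1 := by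
      rw [Nat.cast_sub (by omega)]
      ring
    have ha : (L : ℝ) + k + m + 2 = ((L + m + 1 + k : ℕ) : ℝ) + 1 := by
      push_cast
      ring
    rw [show L + m + 1 + d = L + (m + 1 + d) by ring,
      ← Gamma_natCast_add_one_div (L + (m + 1 + d)) (L + m + 1 + k) (d - k) (by omega), hb, ha,
      Real.Gamma_add_one hd'.ne']
    field_simp
  have hG : ∀ k ∈ Finset.range (q + 1),
      Real.Gamma (((L + (m + 1 + d) : ℕ) : ℝ) + 1) /
          (Real.Gamma ((L : ℝ) + q + m + 2) * Real.Gamma (d : ℝ)) *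
          (((q : ℝ) - k) * Real.Gamma (d : ℝ) * Real.Gamma ((L : ℝ) + q + m + 2) /
              (Real.Gamma ((d : ℝ) + 1 - k - 1) * Real.Gamma ((L : ℝ) + k + m + 3)) * x ^ k)
        = ((q : ℝ) - k) * ((L + m + 1 + d).choose (L + m + 1 + k + 1) : ℝ) * x ^ k := by
    intro k hk
    rw [Finset.mem_range] at hk
    have hb : (d : ℝ) + 1 - k - 1 = ((d - (k + 1) : ℕ) : ℝ) + 1 := by
      rw [Nat.cast_sub (by omega)]
      push_cast
      ring
    have ha : (L : ℝ) + k + m + 3 = ((L + m + 1 + k + 1 : ℕ) : ℝ) + 1 := by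
      push_cast
      ring
    rw [show L + m + 1 + d = L + (m + 1 + d) by ring,
      ← Gamma_natCast_add_one_div (L + (m + 1 + d)) (L + m + 1 + k + 1) (d - (k + 1)) (by omega),
      hb, ha]
    field_simp
  rw [Finset.sum_congr rfl hL, sum_choose_div_gP m d L q hd hx.ne' hg,
    natCast_mul_gP hd (L + m + 1) q hx.ne', ← Finset.sum_congr rfl hF, ← Finset.sum_congr rfl hG,
    ← Finset.mul_sum, ← Finset.mul_sum]
  push_cast
  ring
end
end

section
/- Let N ≥ 1, L ≥ 1 and n be integers with n ≥ N+2. Let x > 0 be a real number with n·x ≠ L and g_j^{(n,L)}(x) ≠ 0 for all 0 ≤ j ≤ N, and let y, z ∈ ℂ with y ≠ 1, z ≠ 1, 1 + x·y·z ≠ 0 and n·x·y·z ≠ L. Define W_M(x,y,z) = q̂_M^{(n,L)}(xy|x)·q̂_M^{(n,L)}(xz|x) − (1 − x·(1−y)(1−z)/(1+x))·q̂_M^{(n,L)}(x|x)·q̂_M^{(n,L)}(xyz|x); r_N(x,y,z) = x·(n−N−1)·q̂_{N−1}^{(n,L)}(xyz|x) + (x/(1+xyz))·[ (L+N)·q̂_N^{(n,L)}(xyz|xyz)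 − xyz·(n−N)·q̂_{N−1}^{(n,L)}(xyz|xyz) − ( N·(1+xyz)/(n·xyz−L) + (n−N)·(1+xyz)/(n·x−L) )·Γ(n+L+1)/(Γ(n+1)·Γ(L)) ]; and R_N(x,y,z) = ĝ_N^{(n,L)}(x)·r_N(x,y,z) − x²·(n−N−1)·Γ(L+n+1)·(xyz)^N·q̂_{N−1}^{(n,L)}(x|x)/(Γ(L+N+1)·Γ(n−N)) + x²·(n−N−1)·Γ(L+n+1)·(xyz)^N·q̂_N^{(n,L)}(x|x)/(Γ(L+N+1)·Γ(n−N+1)) − x·Γ(L+n+1)·(xyz)^{N+1}·q̂_{N+1}^{(n,L)}(x|x)/(Γ(L+N+1)·Γ(n−N)) + x·(L+N+1)·(n−N−1)·Γ(L+n+1)·(xyz)^N·q̂_N^{(n,L)}(x|x)/(Γ(L+N+1)·Γ(n−N+1)). Then x²·ĝ_N^{(n,L)}(x)·G_N^{(n,L)}(x|y,z) = ((1+x)/((1−y)²·(1−z)²))·( (L+N+1)·W_{N+1}(x,y,z) − x·(n−N−1)·W_N(x,y,z) ) + R_N(x,y,z)/((1−y)(1−z)). -/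
open Finset

noncomputable section

/-- `q_N^{(n,L)}(y)` for a complex argument `y`. -/
def qSC (n L : ℝ) (N : ℕ) (y : ℂ) : ℂ :=
  ∑ k ∈ Finset.range (N + 1),
    ((Real.Gamma (L + n + 1) /
        (Real.Gamma ((k : ℝ) + L + 1) * Real.Gamma (n + 1 - k)) : ℝ) : ℂ) * y ^ k

/-- `q̂_N^{(n,L)}(y|x)` for complex arguments. -/
def qhatC (n L : ℝ) (N : ℕ) (y x : ℂ) : ℂ :=
  qSC n L N y + (1 / ((n : ℂ) * x - (L : ℝ))) *
    ((Real.Gamma (L + n + 1) / (Real.Gamma (n + 1) * Real.Gamma L) : ℝ) : ℂ)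

/-- `q_N^{(n,L)}(y)`. -/
def qS (n L : ℝ) (N : ℕ) (y : ℝ) : ℝ :=
  ∑ k ∈ Finset.range (N + 1),
    Real.Gamma (L + n + 1) / (Real.Gamma ((k : ℝ) + L + 1) * Real.Gamma (n + 1 - k)) * y ^ k

/-- `q̂_N^{(n,L)}(y|x)`. -/
def qhat (n L : ℝ) (N : ℕ) (y x : ℝ) : ℝ :=
  qS n L N y + (1 / (n * x - L)) * (Real.Gamma (L + n + 1) / (Real.Gamma (n + 1) * Real.Gamma L))

/-- `ĝ_N^{(n,L)}(x)`. -/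
def ghat (n L : ℝ) (N : ℕ) (x : ℝ) : ℝ :=
  (L + (N : ℝ) + 1) * qhat n L (N + 1) x x - x * (n - N - 1) * qhat n L N x x

/-- The polynomial kernel `G_M^{(n,L)}(x|y,ζ)`. -/
def GNker (n L M : ℕ) (x : ℝ) (y ζ : ℂ) : ℂ :=
  ∑ s ∈ Finset.range M, ∑ t ∈ Finset.range M,
    (gP n L s x : ℝ) * y ^ s * (gP n L t x : ℝ) * ζ ^ t *
      ∑ m ∈ Finset.Icc (max s t) (M - 1),
        ((Real.Gamma ((n : ℝ) + L + 1) /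
            (Real.Gamma ((m : ℝ) + L + 2) * Real.Gamma ((n : ℝ) - m - 1)) *
          (x ^ m / (gP n L (m + 1) x * gP n L m x)) : ℝ) : ℂ)

/-- `W_M^{(n,L)}(x,y,z)`. -/
def WM (n L : ℝ) (M : ℕ) (x : ℝ) (y z : ℂ) : ℂ :=
  qhatC n L M ((x : ℂ) * y) (x : ℂ) * qhatC n L M ((x : ℂ) * z) (x : ℂ)
    - (1 - (x : ℂ) * (1 - y) * (1 - z) / (1 + (x : ℂ))) *
        qhatC n L M (x : ℂ) (x : ℂ) * qhatC n L M ((x : ℂ) * y * z) (x : ℂ)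

/-- `r_N^{(n,L)}(x,y,z)`. -/
def rN (n L : ℝ) (N : ℕ) (x : ℝ) (y z : ℂ) : ℂ :=
  (x : ℂ) * ((n : ℂ) - N - 1) * qhatC n L (N - 1) ((x : ℂ) * y * z) (x : ℂ)
    + ((x : ℂ) / (1 + (x : ℂ) * y * z)) *
      (((L : ℂ) + N) * qhatC n L N ((x : ℂ) * y * z) ((x : ℂ) * y * z)
        - (x : ℂ) * y * z * ((n : ℂ) - N) *
            qhatC n L (N - 1) ((x : ℂ) * y * z) ((x : ℂ) * y * z)
        - ((N : ℂ) * (1 + (x : ℂ) * y * z) / ((n : ℂ) * ((x : ℂ) * y * z) - (L : ℂ))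
            + ((n : ℂ) - N) * (1 + (x : ℂ) * y * z) / ((n : ℂ) * (x : ℂ) - (L : ℂ))) *
          ((Real.Gamma (n + L + 1) / (Real.Gamma (n + 1) * Real.Gamma L) : ℝ) : ℂ))

/-- `R_N^{(n,L)}(x,y,z)`. -/
def RN (n L : ℝ) (N : ℕ) (x : ℝ) (y z : ℂ) : ℂ :=
  ((ghat n L N x : ℝ) : ℂ) * rN n L N x y z
    - (x : ℂ) ^ 2 * ((n : ℂ) - N - 1) * ((Real.Gamma (L + n + 1) : ℝ) : ℂ) *
        ((x : ℂ) * y * z) ^ N * qhatC n L (N - 1) (x : ℂ) (x : ℂ) /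
        (((Real.Gamma (L + N + 1) * Real.Gamma (n - N) : ℝ) : ℂ))
    + (x : ℂ) ^ 2 * ((n : ℂ) - N - 1) * ((Real.Gamma (L + n + 1) : ℝ) : ℂ) *
        ((x : ℂ) * y * z) ^ N * qhatC n L N (x : ℂ) (x : ℂ) /
        (((Real.Gamma (L + N + 1) * Real.Gamma (n - N + 1) : ℝ) : ℂ))
    - (x : ℂ) * ((Real.Gamma (L + n + 1) : ℝ) : ℂ) *
        ((x : ℂ) * y * z) ^ (N + 1) * qhatC n L (N + 1) (x : ℂ) (x : ℂ) /
        (((Real.Gamma (L + N + 1) * Real.Gamma (n - N) : ℝ) : ℂ))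
    + (x : ℂ) * ((L : ℂ) + N + 1) * ((n : ℂ) - N - 1) * ((Real.Gamma (L + n + 1) : ℝ) : ℂ) *
        ((x : ℂ) * y * z) ^ N * qhatC n L N (x : ℂ) (x : ℂ) /
        (((Real.Gamma (L + N + 1) * Real.Gamma (n - N + 1) : ℝ) : ℂ))

section PartialSums

variable {𝕜 : Type*} [Field 𝕜]

/-- The partial sum `∑_{k ≤ j} a k * u ^ k`, shifted by the constant `κ`. -/
def shiftedSum (a : ℕ → 𝕜) (κ : 𝕜) (j : ℕ) (u : 𝕜) : 𝕜 :=
  κ + ∑ k ∈ range (j + 1), a k * u ^ k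

/-- The cumulative sum of the shifted partial sums at `x`. -/
def cumSum (a : ℕ → 𝕜) (κ x : 𝕜) (m : ℕ) : 𝕜 :=
  ∑ j ∈ range (m + 1), shiftedSum a κ j x

/-- The generating polynomial of the cumulative sums. -/
def cumPoly (a : ℕ → 𝕜) (κ x : 𝕜) (m : ℕ) (y : 𝕜) : 𝕜 :=
  ∑ s ∈ range (m + 1), cumSum a κ x s * y ^ s

/-- The rational identity behind the induction step of `shiftedSum_kernel_identity`. -/
theorem kernel_identity_step (x y z l v k a0 a1 a2 A B Q D P h X Y Z : 𝕜)
    (hl1 : l + 1 ≠ 0) (hv : v ≠ 0) (hx : 1 + x ≠ 0)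
    (h0 : l * a1 = v * a0) (h1 : (l + 1) * a2 = (v - 1) * a1)
    (hS : (1 + x) * h = l * (Q + a1 * x * X) - x * (v - 1) * Q) :
    (h + (Q + a1 * x * X)) *
      (l * ((1 + x) * (A + a1 * x * X * y * Y) * (B + a1 * x * X * z * Z)
          - (1 + x - x * (1 - y) * (1 - z)) * (Q + a1 * x * X) * (D + a1 * (x*y*z) * (X*Y*Z)))
        - x * (v - 1) * ((1 + x) * A * B - (1 + x - x * (1 - y) * (1 - z)) * Q * D)
        + (1 - y) * (1 - z) * ((1 + x) * h * (x * (P - k))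
          - x ^ 2 * (v - 1) * v * a0 * (X*Y*Z) * (Q - a0 * X) + x ^ 2 * (v - 1) * a0 * (X*Y*Z) * Q
          - x * v * a0 * (X*Y*Z) * (x*y*z) * (Q + a1 * x * X) + x * l * (v - 1) * a0 * (X*Y*Z) * Q))
    + x ^ 2 * (1 + x) * (v - 1) * a1 * X * (A - y * Y * Q - (1 - y) * (y * Y) * h) *
        (B - z * Z * Q - (1 - z) * (z * Z) * h)
    = h * ((l + 1) * ((1 + x) * (A + a1 * x * X * y * Y + a2 * x ^ 2 * X * y ^ 2 * Y) *
            (B + a1 * x * X * z * Z + a2 * x ^ 2 * X * z ^ 2 * Z)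
          - (1 + x - x * (1 - y) * (1 - z)) * (Q + a1 * x * X + a2 * x ^ 2 * X) *
            (D + a1 * (x*y*z) * (X*Y*Z) + a2 * (x*y*z) ^ 2 * (X*Y*Z)))
        - x * (v - 2) * ((1 + x) * (A + a1 * x * X * y * Y) * (B + a1 * x * X * z * Z)
          - (1 + x - x * (1 - y) * (1 - z)) * (Q + a1 * x * X) * (D + a1 * (x*y*z) * (X*Y*Z)))
        + (1 - y) * (1 - z) * ((1 + x) * (h + (Q + a1 * x * X)) *
            (x * (P + (v - 1) * a0 * (X*Y*Z) - k))
          - x ^ 2 * (v - 2) * (v - 1) * a1 * (X*Y*Z) * (x*y*z) * Q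
          + x ^ 2 * (v - 2) * a1 * (X*Y*Z) * (x*y*z) * (Q + a1 * x * X)
          - x * (v - 1) * a1 * (X*Y*Z) * (x*y*z) ^ 2 * (Q + a1 * x * X + a2 * x ^ 2 * X)
          + x * (l + 1) * (v - 2) * a1 * (X*Y*Z) * (x*y*z) * (Q + a1 * x * X))) := by
  obtain rfl : a0 = l * a1 / v := by field_simp; linear_combination -h0
  obtain rfl : a2 = (v - 1) * a1 / (l + 1) := by field_simp; linear_combination h1
  obtain rfl : h = (l * (Q + a1 * x * X) - x * (v - 1) * Q) / (1 + x) := by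
    field_simp
    linear_combination hS
  field_simp
  ring

variable (a : ℕ → 𝕜) (κ x : 𝕜)

theorem shiftedSum_zero (u : 𝕜) : shiftedSum a κ 0 u = κ + a 0 := by
  simp [shiftedSum]

theorem shiftedSum_succ (j : ℕ) (u : 𝕜) :
    shiftedSum a κ (j + 1) u = shiftedSum a κ j u + a (j + 1) * u ^ (j + 1) := by
  simp only [shiftedSum, sum_range_succ _ (j + 1)]
  ring

theorem cumSum_zero : cumSum a κ x 0 = κ + a 0 := by
  simp [cumSum, shiftedSum_zero]

theorem cumSum_succ (m : ℕ) :
    cumSum a κ x (m + 1) = cumSum a κ x m + shiftedSum a κ (m + 1) x :=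
  sum_range_succ _ _

theorem one_sub_sq_mul_cumPoly (m : ℕ) (y : 𝕜) :
    (1 - y) ^ 2 * cumPoly a κ x m y =
      shiftedSum a κ m (x * y) - y ^ (m + 1) * shiftedSum a κ m x
        - (1 - y) * y ^ (m + 1) * cumSum a κ x m := by
  induction m with
  | zero =>
    simp only [cumPoly, zero_add, sum_range_one, cumSum_zero, shiftedSum_zero]
    ring
  | succ m ih =>
    have hS : cumPoly a κ x (m + 1) y
        = cumPoly a κ x m y + cumSum a κ x (m + 1) * y ^ (m + 1) := sum_range_succ _ _
    rw [hS, mul_add, ih, cumSum_succ, shiftedSum_succ, shiftedSum_succ]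
    ring

variable {a κ x} {n L : 𝕜}

theorem one_add_mul_cumSum (ha : ∀ k : ℕ, (L + k + 1) * a (k + 1) = (n - k) * a k)
    (hκ : (n * x - L) * κ = L * a 0) (m : ℕ) :
    (1 + x) * cumSum a κ x m =
      (L + m + 1) * shiftedSum a κ (m + 1) x - x * (n - m - 1) * shiftedSum a κ m x := by
  induction m with
  | zero =>
    have h0 := ha 0
    simp only [cumSum_zero, shiftedSum_succ, shiftedSum_zero]
    push_cast at h0 ⊢
    linear_combination hκ - x * h0
  | succ m ih =>
    have h1 := ha (m + 1)
    rw [cumSum_succ, mul_add, ih, shiftedSum_succ a κ (m + 1)]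
    rw [shiftedSum_succ a κ m]
    push_cast at h1 ⊢
    linear_combination -x ^ (m + 2) * h1

/-- The closed form of the kernel built from the cumulative sums, for any coefficients with the
hypergeometric recurrence of the binomial coefficients `C(L + n, L + k)`. -/
theorem shiftedSum_kernel_identity
    (ha : ∀ k : ℕ, (L + k + 1) * a (k + 1) = (n - k) * a k)
    (hκ : (n * x - L) * κ = L * a 0) (y z : 𝕜) (N : ℕ)
    (hx : 1 + x ≠ 0) (hl : ∀ k : ℕ, L + k + 1 ≠ 0) (hv : ∀ k < N, n - k ≠ 0)
    (hc : ∀ j ≤ N, cumSum a κ x j ≠ 0) :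
    (1 - y) ^ 2 * (1 - z) ^ 2 * (x ^ 2 * ((1 + x) * cumSum a κ x N) *
        ∑ m ∈ range N, (n - m - 1) * a (m + 1) * x ^ m /
          (cumSum a κ x (m + 1) * cumSum a κ x m) * (cumPoly a κ x m y * cumPoly a κ x m z)) =
      (L + N + 1) * ((1 + x) * shiftedSum a κ (N + 1) (x * y) * shiftedSum a κ (N + 1) (x * z)
          - (1 + x - x * (1 - y) * (1 - z)) *
            shiftedSum a κ (N + 1) x * shiftedSum a κ (N + 1) (x * y * z))
        - x * (n - N - 1) * ((1 + x) * shiftedSum a κ N (x * y) * shiftedSum a κ N (x * z)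
          - (1 + x - x * (1 - y) * (1 - z)) *
            shiftedSum a κ N x * shiftedSum a κ N (x * y * z))
        + (1 - y) * (1 - z) *
          ((1 + x) * cumSum a κ x N *
              (x * (∑ j ∈ range N, (n - j - 1) * a j * (x * y * z) ^ j - κ))
            - x ^ 2 * (n - N - 1) * (n - N) * a N * (x * y * z) ^ N *
              (shiftedSum a κ N x - a N * x ^ N)
            + x ^ 2 * (n - N - 1) * a N * (x * y * z) ^ N * shiftedSum a κ N x
            - x * (n - N) * a N * (x * y * z) ^ (N + 1) * shiftedSum a κ (N + 1) x
            + x * (L + N + 1) * (n - N - 1) * a N * (x * y * z) ^ N * shiftedSum a κ N x) := by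
  induction N with
  | zero =>
    have h0 := ha 0
    simp only [range_zero, sum_empty, cumSum_zero, shiftedSum_succ, shiftedSum_zero]
    push_cast at h0 ⊢
    grind
  | succ N ih =>
    have ih := ih (fun j hj => hv j (by omega)) fun j hj => hc j (by omega)
    have hc0 := hc N (by omega)
    have hc1 := hc (N + 1) le_rfl
    have hy := one_sub_sq_mul_cumPoly a κ x N y
    have hz := one_sub_sq_mul_cumPoly a κ x N z
    have h1 := ha (N + 1)
    have hl1 := hl (N + 1)
    have hS := one_add_mul_cumSum ha hκ N
    rw [shiftedSum_succ a κ N x] at hS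
    push_cast at h1 hl1
    have key := kernel_identity_step x y z (L + N + 1) (n - N) κ (a N) (a (N + 1)) (a (N + 2))
      (shiftedSum a κ N (x * y)) (shiftedSum a κ N (x * z)) (shiftedSum a κ N x)
      (shiftedSum a κ N (x * y * z)) (∑ j ∈ range N, (n - j - 1) * a j * (x * y * z) ^ j)
      (cumSum a κ x N) (x ^ N) (y ^ N) (z ^ N) (by convert hl1 using 1; ring)
      (hv N (by omega)) hx (ha N) (by linear_combination h1) (by linear_combination hS)
    refine mul_left_cancel₀ hc0 ?_
    rw [cumSum_succ] at hc1
    simp only [shiftedSum_succ, cumSum_succ, sum_range_succ _ N] at ih hc1 ⊢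
    push_cast
    generalize (∑ m ∈ range N, (n - m - 1) * a (m + 1) * x ^ m /
      ((cumSum a κ x m + (shiftedSum a κ m x + a (m + 1) * x ^ (m + 1))) * cumSum a κ x m) *
        (cumPoly a κ x m y * cumPoly a κ x m z)) = σ at ih ⊢
    have hterm : (n - N - 1) * a (N + 1) * x ^ N /
        ((cumSum a κ x N + (shiftedSum a κ N x + a (N + 1) * x ^ (N + 1))) * cumSum a κ x N) *
        (cumPoly a κ x N y * cumPoly a κ x N z) *
        ((cumSum a κ x N + (shiftedSum a κ N x + a (N + 1) * x ^ (N + 1))) * cumSum a κ x N) =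
        (n - N - 1) * a (N + 1) * x ^ N * (cumPoly a κ x N y * cumPoly a κ x N z) := by
      field_simp
    generalize (n - N - 1) * a (N + 1) * x ^ N /
        ((cumSum a κ x N + (shiftedSum a κ N x + a (N + 1) * x ^ (N + 1))) * cumSum a κ x N) *
        (cumPoly a κ x N y * cumPoly a κ x N z) = τ at hterm ⊢
    have hyz : ((1 - y) ^ 2 * cumPoly a κ x N y) * ((1 - z) ^ 2 * cumPoly a κ x N z) = _ :=
      congr_arg₂ (· * ·) hy hz
    generalize ∑ j ∈ range N, (n - j - 1) * a j * (x * y * z) ^ j = ρ at key ih ⊢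
    clear hy hz
    linear_combination key +
      (cumSum a κ x N + (shiftedSum a κ N x + a (N + 1) * x ^ (N + 1))) * ih +
      (1 - y) ^ 2 * (1 - z) ^ 2 * x ^ 2 * (1 + x) * hterm +
      x ^ 2 * (1 + x) * (n - N - 1) * a (N + 1) * x ^ N * hyz

theorem cumSum_eq_sum (a : ℕ → 𝕜) (κ x : 𝕜) (m : ℕ) :
    cumSum a κ x m =
      ∑ k ∈ range (m + 1), ((m : 𝕜) + 1 - k) * a k * x ^ k + (m + 1) * κ := by
  induction m with
  | zero => simp [cumSum_zero, add_comm]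
  | succ m ih =>
    rw [cumSum_succ, ih, shiftedSum, sum_range_succ _ (m + 1), sum_range_succ _ (m + 1)]
    have : ∑ k ∈ range (m + 1), (((m + 1 : ℕ) : 𝕜) + 1 - k) * a k * x ^ k =
        ∑ k ∈ range (m + 1), ((m : 𝕜) + 1 - k) * a k * x ^ k +
          ∑ k ∈ range (m + 1), a k * x ^ k := by
      rw [← sum_add_distrib]
      refine sum_congr rfl fun k _ => ?_
      push_cast
      ring
    rw [this]
    push_cast
    ring

theorem one_add_mul_weighted_sum (ha : ∀ k : ℕ, (L + k + 1) * a (k + 1) = (n - k) * a k)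
    (κ w : 𝕜) (m : ℕ) :
    (1 + w) * (∑ j ∈ range (m + 1), (n - j - 1) * a j * w ^ j
        - (n - m - 2) * (shiftedSum a κ m w - κ)) =
      (L + m + 1) * (shiftedSum a κ (m + 1) w - κ)
        - w * (n - m - 1) * (shiftedSum a κ m w - κ) - L * a 0 := by
  induction m with
  | zero =>
    have h0 := ha 0
    simp only [shiftedSum_succ, shiftedSum_zero, zero_add, sum_range_one]
    push_cast at h0 ⊢
    linear_combination -w * h0
  | succ m ih =>
    have h1 := ha (m + 1)
    rw [sum_range_succ, shiftedSum_succ a κ (m + 1)]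
    rw [shiftedSum_succ a κ m] at ih ⊢
    push_cast at h1 ⊢
    linear_combination ih - w ^ (m + 2) * h1

end PartialSums

theorem sum_sum_Icc_max {M : Type*} [AddCommMonoid M] (N : ℕ) (f : ℕ → ℕ → ℕ → M) :
    ∑ s ∈ range N, ∑ t ∈ range N, ∑ m ∈ Icc (max s t) (N - 1), f s t m =
      ∑ m ∈ range N, ∑ s ∈ range (m + 1), ∑ t ∈ range (m + 1), f s t m := by
  have h1 : ∀ s ∈ range N, ∑ t ∈ range N, ∑ m ∈ Icc (max s t) (N - 1), f s t m =
      ∑ m ∈ Icc s (N - 1), ∑ t ∈ range (m + 1), f s t m := fun s hs => by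
    refine sum_comm' fun t m => ?_
    simp only [mem_range, mem_Icc] at hs ⊢
    omega
  rw [sum_congr rfl h1]
  refine sum_comm' fun s m => ?_
  simp only [mem_range, mem_Icc]
  omega

theorem Gamma_ratio_eq_choose (n L k : ℕ) (hk : k ≤ n) :
    Real.Gamma ((L : ℝ) + n + 1) /
        (Real.Gamma ((k : ℝ) + L + 1) * Real.Gamma ((n : ℝ) + 1 - k)) =
      (L + n).choose (L + k) := by
  obtain ⟨d, rfl⟩ := Nat.exists_eq_add_of_le hk
  have h1 : (L : ℝ) + (k + d : ℕ) + 1 = ((L + (k + d) : ℕ) : ℝ) + 1 := by push_cast; ring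
  have h2 : (k : ℝ) + L + 1 = ((L + k : ℕ) : ℝ) + 1 := by push_cast; ring
  have h3 : ((k + d : ℕ) : ℝ) + 1 - k = (d : ℝ) + 1 := by push_cast; ring
  rw [h1, h2, h3, Real.Gamma_nat_eq_factorial, Real.Gamma_nat_eq_factorial,
    Real.Gamma_nat_eq_factorial, ← add_assoc, Nat.cast_add_choose]

theorem Gamma_ratio_sub_eq_choose (n L k : ℕ) (hk : k < n) :
    Real.Gamma ((L : ℝ) + n + 1) /
        (Real.Gamma ((k : ℝ) + L + 1) * Real.Gamma ((n : ℝ) - k)) =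
      (n - k) * (L + n).choose (L + k) := by
  have hpos : (0 : ℝ) < n - k := sub_pos.2 (by exact_mod_cast hk)
  have hΓ := (Real.Gamma_pos_of_pos hpos).ne'
  rw [← Gamma_ratio_eq_choose n L k hk.le, add_sub_right_comm, Real.Gamma_add_one hpos.ne']
  field_simp

theorem Gamma_ratio_eq_mul_choose (n L : ℕ) (hL : 1 ≤ L) :
    Real.Gamma ((L : ℝ) + n + 1) / (Real.Gamma ((n : ℝ) + 1) * Real.Gamma L) =
      L * (L + n).choose L := by
  have hpos : (0 : ℝ) < L := by exact_mod_cast hL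
  have h := Gamma_ratio_eq_choose n L 0 n.zero_le
  have hΓ := (Real.Gamma_pos_of_pos hpos).ne'
  rw [add_zero] at h
  rw [← h, Nat.cast_zero, zero_add, sub_zero, Real.Gamma_add_one hpos.ne']
  field_simp

theorem choose_recurrence (n L k : ℕ) :
    ((L : ℂ) + k + 1) * ((L + n).choose (L + (k + 1)) : ℂ) =
      (n - k) * ((L + n).choose (L + k) : ℂ) := by
  rcases lt_or_ge n k with h | h
  · rw [Nat.choose_eq_zero_of_lt (by omega : L + n < L + (k + 1)),
      Nat.choose_eq_zero_of_lt (by omega : L + n < L + k)]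
    simp
  · have := Nat.choose_succ_right_eq (L + n) (L + k)
    rw [Nat.add_sub_add_left] at this
    have := congr_arg (Nat.cast : ℕ → ℂ) this
    push_cast [h] at this
    rw [← add_assoc L k 1]
    linear_combination this

theorem qhatC_eq_shiftedSum (n L M : ℕ) (hL : 1 ≤ L) (hM : M ≤ n) (u v : ℂ) :
    qhatC n L M u v =
      shiftedSum (fun k => ((L + n).choose (L + k) : ℂ))
        (L * (L + n).choose L / (n * v - L)) M u := by
  rw [qhatC, qSC, Gamma_ratio_eq_mul_choose n L hL, shiftedSum, add_comm]
  congr 1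
  · push_cast
    ring
  · refine sum_congr rfl fun k hk => ?_
    rw [Gamma_ratio_eq_choose n L k (by grind), Complex.ofReal_natCast]

theorem ofReal_qhat (n L : ℝ) (M : ℕ) (x y : ℝ) :
    ((qhat n L M x y : ℝ) : ℂ) = qhatC n L M x y := by
  simp only [qhat, qhatC, qS, qSC, Complex.ofReal_add, Complex.ofReal_mul, Complex.ofReal_sum,
    Complex.ofReal_pow, Complex.ofReal_div, Complex.ofReal_sub, Complex.ofReal_one]

theorem ofReal_gP (n L m : ℕ) (hn : n ≠ 0) (x : ℝ) (hx : x ≠ 0) (hxL : (n : ℝ) * x ≠ L) :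
    ((gP n L m x : ℝ) : ℂ) =
      ((n : ℂ) * x - L) / (n * x) *
        cumSum (fun k => ((L + n).choose (L + k) : ℂ))
          (L * (L + n).choose L / (n * x - L)) (x : ℂ) m := by
  have hn' : (n : ℂ) ≠ 0 := by exact_mod_cast hn
  have hx' : (x : ℂ) ≠ 0 := by exact_mod_cast hx
  have hc : (n : ℂ) * x - L ≠ 0 := sub_ne_zero.2 (by exact_mod_cast hxL)
  have hκ : ((n : ℂ) * x - L) * (L * (L + n).choose L / (n * x - L)) = L * (L + n).choose L :=
    mul_div_cancel₀ _ hc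
  rw [cumSum_eq_sum, gP]
  generalize (L : ℂ) * (L + n).choose L / (n * x - L) = κ at *
  push_cast
  field_simp
  linear_combination -(m + 1) * hκ

theorem ofReal_ghat (n L N : ℕ) (hL : 1 ≤ L) (hn : N + 1 ≤ n) (x : ℝ)
    (hxL : (n : ℝ) * x ≠ L) :
    ((ghat n L N x : ℝ) : ℂ) =
      (1 + x) * cumSum (fun k => ((L + n).choose (L + k) : ℂ))
          (L * (L + n).choose L / (n * x - L)) (x : ℂ) N := by
  have hc : (n : ℂ) * x - L ≠ 0 := sub_ne_zero.2 (by exact_mod_cast hxL)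
  rw [one_add_mul_cumSum (n := (n : ℂ)) (L := (L : ℂ)) (choose_recurrence n L)
    (by rw [add_zero]; field_simp), ghat]
  push_cast [ofReal_qhat]
  rw [qhatC_eq_shiftedSum n L _ hL hn, qhatC_eq_shiftedSum n L _ hL (by omega)]

theorem GNker_eq_sum (n L N : ℕ) (hn : N + 1 ≤ n) (x : ℝ) (hx : x ≠ 0)
    (hxL : (n : ℝ) * x ≠ L) (y z : ℂ) :
    GNker n L N x y z =
      ∑ m ∈ range N, ((n : ℂ) - m - 1) * ((L + n).choose (L + (m + 1)) : ℂ) * (x : ℂ) ^ m /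
        (cumSum (fun k => ((L + n).choose (L + k) : ℂ))
            (L * (L + n).choose L / (n * x - L)) (x : ℂ) (m + 1) *
          cumSum (fun k => ((L + n).choose (L + k) : ℂ))
            (L * (L + n).choose L / (n * x - L)) (x : ℂ) m) *
        (cumPoly (fun k => ((L + n).choose (L + k) : ℂ))
            (L * (L + n).choose L / (n * x - L)) (x : ℂ) m y *
          cumPoly (fun k => ((L + n).choose (L + k) : ℂ))
            (L * (L + n).choose L / (n * x - L)) (x : ℂ) m z) := by
  have hn' : (n : ℂ) ≠ 0 := by exact_mod_cast (by omega : n ≠ 0)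
  have hx' : (x : ℂ) ≠ 0 := by exact_mod_cast hx
  have hc : (n : ℂ) * x - L ≠ 0 := sub_ne_zero.2 (by exact_mod_cast hxL)
  simp only [GNker, mul_sum]
  rw [sum_sum_Icc_max]
  refine sum_congr rfl fun m hm => ?_
  have hm : m + 1 < n := by grind
  have hΓ : Real.Gamma ((n : ℝ) + L + 1) /
      (Real.Gamma ((m : ℝ) + L + 2) * Real.Gamma ((n : ℝ) - m - 1)) =
        (n - m - 1) * (L + n).choose (L + (m + 1)) := by
    have := Gamma_ratio_sub_eq_choose n L (m + 1) hm
    push_cast at this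
    rw [show (n : ℝ) + L + 1 = L + n + 1 by ring, show (m : ℝ) + L + 2 = m + 1 + L + 1 by ring,
      sub_sub, this]
  rw [hΓ, cumPoly, cumPoly, sum_mul_sum, mul_sum]
  refine sum_congr rfl fun s _ => ?_
  rw [mul_sum]
  refine sum_congr rfl fun t _ => ?_
  push_cast [ofReal_gP n L _ (by omega : n ≠ 0) x hx hxL]
  field_simp

theorem rN_eq_sum (n L N : ℕ) (hN : 1 ≤ N) (hL : 1 ≤ L) (hn : N ≤ n) (x : ℝ) (y z : ℂ)
    (hxyz : 1 + (x : ℂ) * y * z ≠ 0) (hxyzL : (n : ℂ) * ((x : ℂ) * y * z) ≠ L) :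
    rN n L N x y z =
      x * (∑ j ∈ range N, ((n : ℂ) - j - 1) * ((L + n).choose (L + j) : ℂ) * (x * y * z) ^ j
        - L * (L + n).choose L / (n * x - L)) := by
  obtain ⟨M, rfl⟩ := Nat.exists_eq_add_of_le' hN
  have hcw : (n : ℂ) * ((x : ℂ) * y * z) - L ≠ 0 := sub_ne_zero.2 hxyzL
  have hΓ : Real.Gamma ((n : ℝ) + L + 1) / (Real.Gamma ((n : ℝ) + 1) * Real.Gamma L) =
      L * (L + n).choose L := by
    rw [add_comm (n : ℝ) L, Gamma_ratio_eq_mul_choose n L hL]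
  rw [rN, hΓ]
  simp only [Nat.add_sub_cancel, qhatC_eq_shiftedSum n L _ hL hn,
    qhatC_eq_shiftedSum n L M hL (by omega)]
  push_cast
  have key := one_add_mul_weighted_sum (a := fun k => ((L + n).choose (L + k) : ℂ))
    (choose_recurrence n L) 0 ((x : ℂ) * y * z) M
  simp only [shiftedSum, add_zero, zero_add, sub_zero] at key ⊢
  generalize ∑ j ∈ range (M + 1), ((n : ℂ) - j - 1) * ((L + n).choose (L + j) : ℂ) *
    ((x : ℂ) * y * z) ^ j = σ at key ⊢
  generalize ∑ k ∈ range (M + 1), ((L + n).choose (L + k) : ℂ) * ((x : ℂ) * y * z) ^ k = s₀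
    at key ⊢
  generalize ∑ k ∈ range (M + 1 + 1), ((L + n).choose (L + k) : ℂ) * ((x : ℂ) * y * z) ^ k = s₁
    at key ⊢
  generalize (x : ℂ) * y * z = w at *
  have hκ : (n * w - L) * (n * w - L)⁻¹ = 1 := mul_inv_cancel₀ hcw
  have hw : (1 + w) * (1 + w)⁻¹ = 1 := mul_inv_cancel₀ hxyz
  simp only [div_eq_mul_inv]
  generalize ((n : ℂ) * w - L)⁻¹ = i at *
  generalize ((n : ℂ) * x - L)⁻¹ = j at *
  linear_combination -x * (1 + w)⁻¹ * key - x * (1 + w)⁻¹ * L * (L + n).choose L * hκ +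
    x * (σ - (n - M - 2) * s₀ - (n - M - 1) * L * (L + n).choose L * j) * hw

/-- Simplification of the finite-`N` polynomial kernel of the overlap for the induced
spherical unitary ensemble. -/
theorem kernel_simplification (N L n : ℕ) (hN : 1 ≤ N) (hL : 1 ≤ L) (hn : N + 2 ≤ n)
    (x : ℝ) (hx : 0 < x) (hxL : (n : ℝ) * x ≠ L)
    (hg : ∀ j ≤ N, gP n L j x ≠ 0)
    (y z : ℂ) (hy : y ≠ 1) (hz : z ≠ 1)
    (hxyz : 1 + (x : ℂ) * y * z ≠ 0) (hxyzL : (n : ℂ) * ((x : ℂ) * y * z) ≠ (L : ℂ)) :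
    ((x ^ 2 * ghat n L N x : ℝ) : ℂ) * GNker n L N x y z
      = ((1 + (x : ℂ)) / ((1 - y) ^ 2 * (1 - z) ^ 2)) *
          (((L : ℂ) + N + 1) * WM n L (N + 1) x y z
            - (x : ℂ) * ((n : ℂ) - N - 1) * WM n L N x y z)
        + RN n L N x y z / ((1 - y) * (1 - z)) := by
  have hx0 : (1 : ℂ) + x ≠ 0 := by exact_mod_cast (by positivity : 1 + x ≠ 0)
  have hy1 : 1 - y ≠ 0 := sub_ne_zero.2 hy.symm
  have hz1 : 1 - z ≠ 0 := sub_ne_zero.2 hz.symm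
  have hc : (n : ℂ) * x - L ≠ 0 := sub_ne_zero.2 (by exact_mod_cast hxL)
  have hΓ₁ (b c d : ℂ) : b * ((Real.Gamma (L + n + 1) : ℝ) : ℂ) * c * d /
      ((Real.Gamma (L + N + 1) * Real.Gamma (n - N) : ℝ) : ℂ) =
        (n - N) * (L + n).choose (L + N) * (b * c * d) := by
    have h := congr_arg ((↑) : ℝ → ℂ) (Gamma_ratio_sub_eq_choose n L N (by omega))
    rw [add_comm (N : ℝ) L, Complex.ofReal_div] at h
    push_cast at h ⊢
    linear_combination b * c * d * h
  have hΓ₂ (b c d : ℂ) : b * ((Real.Gamma (L + n + 1) : ℝ) : ℂ) * c * d /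
      ((Real.Gamma (L + N + 1) * Real.Gamma (n - N + 1) : ℝ) : ℂ) =
        (L + n).choose (L + N) * (b * c * d) := by
    have h := congr_arg ((↑) : ℝ → ℂ) (Gamma_ratio_eq_choose n L N (by omega))
    rw [add_comm (N : ℝ) L, ← sub_add_eq_add_sub, Complex.ofReal_div] at h
    push_cast at h ⊢
    linear_combination b * c * d * h
  have key := shiftedSum_kernel_identity (a := fun k => ((L + n).choose (L + k) : ℂ))
    (κ := L * (L + n).choose L / (n * x - L)) (x := (x : ℂ)) (choose_recurrence n L)
    (by rw [add_zero]; exact mul_div_cancel₀ _ hc) y z N hx0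
    (fun k => by exact_mod_cast (L + k).succ_ne_zero)
    (fun k hk => sub_ne_zero.2 (by exact_mod_cast (by omega : n ≠ k)))
    (fun j hj h => hg j hj (by
      rw [← Complex.ofReal_eq_zero, ofReal_gP n L j (by omega) x hx.ne' hxL, h, mul_zero]))
  have hS := shiftedSum_succ (fun k => ((L + n).choose (L + k) : ℂ))
    (L * (L + n).choose L / (n * x - L)) (N - 1) (x : ℂ)
  rw [Nat.sub_add_cancel hN] at hS
  rw [Complex.ofReal_mul, Complex.ofReal_pow, ofReal_ghat n L N hL (by omega) x hxL,
    GNker_eq_sum n L N (by omega) x hx.ne' hxL, RN, ofReal_ghat n L N hL (by omega) x hxL,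
    rN_eq_sum n L N hN hL (by omega) x y z hxyz hxyzL, WM, WM]
  simp only [qhatC_eq_shiftedSum n L (N + 1) hL (by omega),
    qhatC_eq_shiftedSum n L N hL (by omega), qhatC_eq_shiftedSum n L (N - 1) hL (by omega),
    Complex.ofReal_natCast]
  rw [eq_sub_of_add_eq hS.symm]
  simp only [hΓ₁, hΓ₂]
  refine mul_left_cancel₀ (mul_ne_zero (pow_ne_zero 2 hy1) (pow_ne_zero 2 hz1)) (key.trans ?_)
  clear key hS hΓ₁ hΓ₂
  generalize (L : ℂ) * (L + n).choose L / (n * x - L) = κ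
  field_simp
end
end

section
/- Let a ≥ 0 and b > 0 be real numbers (with the convention 1/Γ(0) = 0 when a = 0), and let p > 0 be a real number with a/(b+1) < p² < (a+1)/b. For each positive integer N set L_N = a·N, n_N = (b+1)·N, δ_N = (n_N + L_N + 1)/(N·(1+p²)²). Fix real numbers s, t, χ and set z_N = p + s/√(N·δ_N), w_N = p + t/√(N·δ_N), λ_N = p + χ/√(N·δ_N). Then lim_{N→∞} q̂_{N−1}^{(n_N,L_N)}(z_N·w_N | λ_N²) · (z_N·w_N)^{L_N} · ((1+z_N²)(1+w_N²))^{−(n_N+L_N+1)/2} = e^{−(s−t)²/2}/(1+p²), where all powers with real exponents are real powers. -/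
open Finset Filter

noncomputable section

/-- The cumulative distribution function of the beta distribution, for `0 ≤ x ≤ 1`. -/
def betaCdf (α β x : ℝ) : ℝ :=
  (ProbabilityTheory.beta α β)⁻¹ * ∫ u in (0 : ℝ)..x, u ^ (α - 1) * (1 - u) ^ (β - 1)

lemma continuous_rpow_mul_one_sub_rpow {p q : ℝ} (hp : 0 ≤ p) (hq : 0 ≤ q) :
    Continuous fun u : ℝ => u ^ p * (1 - u) ^ q :=
  (Real.continuous_rpow_const hp).mul
    ((Real.continuous_rpow_const hq).comp (continuous_const.sub continuous_id))

lemma integral_rpow_mul_one_sub_rpow {α β : ℝ} (hα : 0 < α) (hβ : 0 < β) :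
    ∫ u in (0 : ℝ)..1, u ^ (α - 1) * (1 - u) ^ (β - 1) = ProbabilityTheory.beta α β := by
  rw [ProbabilityTheory.beta_eq_betaIntegralReal α β hα hβ, Complex.betaIntegral,
    ← Complex.ofReal_re (∫ u in (0 : ℝ)..1, u ^ (α - 1) * (1 - u) ^ (β - 1)),
    ← intervalIntegral.integral_ofReal]
  congr 1
  refine intervalIntegral.integral_congr fun u hu => ?_
  rw [Set.uIcc_of_le zero_le_one] at hu
  have h1 : (0 : ℝ) ≤ 1 - u := sub_nonneg.2 hu.2
  push_cast [Complex.ofReal_cpow hu.1, Complex.ofReal_cpow h1]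
  rfl

lemma beta_add_one_left {α β : ℝ} (hα : 0 < α) (hβ : 0 < β) :
    ProbabilityTheory.beta (α + 1) β = α / (α + β) * ProbabilityTheory.beta α β := by
  have hs : 0 < α + β := add_pos hα hβ
  have hΓ := (Real.Gamma_pos_of_pos hs).ne'
  rw [ProbabilityTheory.beta, ProbabilityTheory.beta, Real.Gamma_add_one hα.ne',
    show α + 1 + β = α + β + 1 by ring, Real.Gamma_add_one hs.ne']
  field_simp

/-- The (unnormalized) variance of the beta distribution. -/
lemma integral_sq_sub_mean_mul {α β : ℝ} (hα : 1 ≤ α) (hβ : 1 ≤ β) :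
    ∫ u in (0 : ℝ)..1, (u - α / (α + β)) ^ 2 * (u ^ (α - 1) * (1 - u) ^ (β - 1)) =
      α * β / ((α + β) ^ 2 * (α + β + 1)) * ProbabilityTheory.beta α β := by
  have hα0 : 0 < α := by linarith
  have hβ0 : 0 < β := by linarith
  set m := α / (α + β) with hm
  have hcont : ∀ q : ℝ, 0 ≤ q → IntervalIntegrable
      (fun u : ℝ => u ^ q * (1 - u) ^ (β - 1)) MeasureTheory.volume 0 1 := fun q hq =>
    (continuous_rpow_mul_one_sub_rpow hq (sub_nonneg.2 hβ)).intervalIntegrable _ _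
  have hexp : ∫ u in (0 : ℝ)..1, (u - m) ^ 2 * (u ^ (α - 1) * (1 - u) ^ (β - 1)) =
      ∫ u in (0 : ℝ)..1, (u ^ (α + 1 + 1 - 1) * (1 - u) ^ (β - 1)
        - 2 * m * (u ^ (α + 1 - 1) * (1 - u) ^ (β - 1)))
        + m ^ 2 * (u ^ (α - 1) * (1 - u) ^ (β - 1)) := by
    refine intervalIntegral.integral_congr fun u hu => ?_
    rw [Set.uIcc_of_le zero_le_one] at hu
    have h1 : u ^ (α + 1 - 1) = u ^ (α - 1) * u := by
      rw [show α + 1 - 1 = (α - 1) + 1 by ring,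
        Real.rpow_add_of_nonneg hu.1 (by linarith) zero_le_one, Real.rpow_one]
    have h2 : u ^ (α + 1 + 1 - 1) = u ^ (α - 1) * u * u := by
      rw [← h1, show α + 1 + 1 - 1 = (α + 1 - 1) + 1 by ring,
        Real.rpow_add_of_nonneg hu.1 (by linarith) zero_le_one, Real.rpow_one]
    simp only [h1, h2]
    ring
  rw [hexp, intervalIntegral.integral_add
      ((hcont _ (by linarith)).sub ((hcont _ (by linarith)).const_mul _))
      ((hcont _ (by linarith)).const_mul _),
    intervalIntegral.integral_sub (hcont _ (by linarith)) ((hcont _ (by linarith)).const_mul _),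
    intervalIntegral.integral_const_mul, intervalIntegral.integral_const_mul,
    integral_rpow_mul_one_sub_rpow (by linarith) hβ0,
    integral_rpow_mul_one_sub_rpow (by linarith) hβ0,
    integral_rpow_mul_one_sub_rpow hα0 hβ0,
    beta_add_one_left (by linarith) hβ0, beta_add_one_left hα0 hβ0, hm]
  field_simp
  ring

lemma integral_sq_sub_mean_mul_le {α β : ℝ} (hα : 1 ≤ α) (hβ : 1 ≤ β) :
    ∫ u in (0 : ℝ)..1, (u - α / (α + β)) ^ 2 * (u ^ (α - 1) * (1 - u) ^ (β - 1)) ≤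
      (α + β)⁻¹ * ProbabilityTheory.beta α β := by
  rw [integral_sq_sub_mean_mul hα hβ]
  refine mul_le_mul_of_nonneg_right ?_
    (ProbabilityTheory.beta_pos (by linarith) (by linarith)).le
  rw [inv_eq_one_div, div_le_div_iff₀ (by positivity) (by positivity)]
  nlinarith [mul_nonneg (zero_le_one.trans hα) (zero_le_one.trans hβ),
    sq_nonneg (α - β), sq_nonneg (α + β), mul_nonneg (sq_nonneg (α + β)) (by linarith : 0 ≤ α + β),
    mul_nonneg (add_nonneg (sq_nonneg α) (sq_nonneg β)) (by linarith : 0 ≤ α + β)]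

/-- Chebyshev's inequality for the beta distribution, on a subinterval of `[0, 1]`. -/
lemma integral_le_of_dist_mean_le {α β x y d : ℝ} (hα : 1 ≤ α) (hβ : 1 ≤ β) (hx : 0 ≤ x)
    (hxy : x ≤ y) (hy : y ≤ 1) (hd : 0 < d)
    (h : ∀ u ∈ Set.Icc x y, d ^ 2 ≤ (u - α / (α + β)) ^ 2) :
    (ProbabilityTheory.beta α β)⁻¹ * ∫ u in x..y, u ^ (α - 1) * (1 - u) ^ (β - 1) ≤
      (α + β)⁻¹ / d ^ 2 := by
  have hB : 0 < ProbabilityTheory.beta α β :=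
    ProbabilityTheory.beta_pos (by linarith) (by linarith)
  have hc := continuous_rpow_mul_one_sub_rpow (sub_nonneg.2 hα) (sub_nonneg.2 hβ)
  have hc2 : Continuous fun u : ℝ =>
      (u - α / (α + β)) ^ 2 * (u ^ (α - 1) * (1 - u) ^ (β - 1)) :=
    ((continuous_id.sub continuous_const).pow 2).mul hc
  have hnn : ∀ u ∈ Set.Icc (0 : ℝ) 1, 0 ≤ u ^ (α - 1) * (1 - u) ^ (β - 1) := fun u hu =>
    mul_nonneg (Real.rpow_nonneg hu.1 _) (Real.rpow_nonneg (sub_nonneg.2 hu.2) _)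
  have h1 : d ^ 2 * ∫ u in x..y, u ^ (α - 1) * (1 - u) ^ (β - 1) ≤
      ∫ u in x..y, (u - α / (α + β)) ^ 2 * (u ^ (α - 1) * (1 - u) ^ (β - 1)) := by
    rw [← intervalIntegral.integral_const_mul]
    refine intervalIntegral.integral_mono_on hxy
      ((continuous_const.mul hc).intervalIntegrable _ _) (hc2.intervalIntegrable _ _) fun u hu => ?_
    exact mul_le_mul_of_nonneg_right (h u hu) (hnn u ⟨hx.trans hu.1, hu.2.trans hy⟩)
  have h2 : ∫ u in x..y, (u - α / (α + β)) ^ 2 * (u ^ (α - 1) * (1 - u) ^ (β - 1)) ≤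
      ∫ u in (0 : ℝ)..1, (u - α / (α + β)) ^ 2 * (u ^ (α - 1) * (1 - u) ^ (β - 1)) := by
    refine intervalIntegral.integral_mono_interval hx hxy hy ?_ (hc2.intervalIntegrable _ _)
    refine (MeasureTheory.ae_restrict_iff' measurableSet_Ioc).2 (Eventually.of_forall fun u hu => ?_)
    exact mul_nonneg (sq_nonneg _) (hnn u ⟨hu.1.le, hu.2⟩)
  have h3 := (h1.trans h2).trans (integral_sq_sub_mean_mul_le hα hβ)
  rw [inv_mul_le_iff₀ hB, mul_div_assoc', le_div_iff₀ (by positivity)]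
  linarith

lemma betaCdf_nonneg {α β x : ℝ} (hα : 0 < α) (hβ : 0 < β) (hx : 0 ≤ x) (hx1 : x ≤ 1) :
    0 ≤ betaCdf α β x := by
  refine mul_nonneg (inv_nonneg.2 (ProbabilityTheory.beta_pos hα hβ).le)
    (intervalIntegral.integral_nonneg hx fun u hu => ?_)
  exact mul_nonneg (Real.rpow_nonneg hu.1 _)
    (Real.rpow_nonneg (sub_nonneg.2 (hu.2.trans hx1)) _)

lemma one_sub_betaCdf {α β x : ℝ} (hα : 1 ≤ α) (hβ : 1 ≤ β) :
    1 - betaCdf α β x = (ProbabilityTheory.beta α β)⁻¹ *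
      ∫ u in x..1, u ^ (α - 1) * (1 - u) ^ (β - 1) := by
  have hα0 : 0 < α := by linarith
  have hβ0 : 0 < β := by linarith
  have hc := continuous_rpow_mul_one_sub_rpow (sub_nonneg.2 hα) (sub_nonneg.2 hβ)
  rw [← intervalIntegral.integral_interval_sub_left (hc.intervalIntegrable 0 1)
      (hc.intervalIntegrable 0 x), integral_rpow_mul_one_sub_rpow hα0 hβ0, mul_sub,
    inv_mul_cancel₀ (ProbabilityTheory.beta_pos hα0 hβ0).ne', betaCdf]

lemma tendsto_betaCdf_zero {ι : Type*} {l : Filter ι} {α β x : ι → ℝ} {m x₀ : ℝ}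
    (hα : ∀ᶠ i in l, 1 ≤ α i) (hβ : ∀ᶠ i in l, 1 ≤ β i) (hx : ∀ᶠ i in l, x i ∈ Set.Icc (0 : ℝ) 1)
    (hαβ : Tendsto (fun i => α i + β i) l atTop)
    (hm : Tendsto (fun i => α i / (α i + β i)) l (nhds m)) (hx₀ : Tendsto x l (nhds x₀))
    (h : x₀ < m) : Tendsto (fun i => betaCdf (α i) (β i) (x i)) l (nhds 0) := by
  have hlim : Tendsto (fun i => (α i + β i)⁻¹ / ((m - x₀) / 2) ^ 2) l (nhds 0) := by
    simpa using hαβ.inv_tendsto_atTop.div_const (((m - x₀) / 2) ^ 2)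
  have hdist := (hm.sub hx₀).eventually_const_lt (show (m - x₀) / 2 < m - x₀ by linarith)
  refine tendsto_of_tendsto_of_tendsto_of_le_of_le' tendsto_const_nhds hlim ?_ ?_
  · filter_upwards [hα, hβ, hx] with i h1 h2 h3
    exact betaCdf_nonneg (by linarith) (by linarith) h3.1 h3.2
  · filter_upwards [hα, hβ, hx, hdist] with i h1 h2 h3 h4
    refine integral_le_of_dist_mean_le h1 h2 le_rfl h3.1 h3.2 (by linarith) fun u hu => ?_
    rw [sub_sq_comm u]
    exact pow_le_pow_left₀ (by linarith) (by linarith [hu.2]) 2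

lemma tendsto_betaCdf_one {ι : Type*} {l : Filter ι} {α β x : ι → ℝ} {m x₀ : ℝ}
    (hα : ∀ᶠ i in l, 1 ≤ α i) (hβ : ∀ᶠ i in l, 1 ≤ β i) (hx : ∀ᶠ i in l, x i ∈ Set.Icc (0 : ℝ) 1)
    (hαβ : Tendsto (fun i => α i + β i) l atTop)
    (hm : Tendsto (fun i => α i / (α i + β i)) l (nhds m)) (hx₀ : Tendsto x l (nhds x₀))
    (h : m < x₀) : Tendsto (fun i => betaCdf (α i) (β i) (x i)) l (nhds 1) := by
  have hlim : Tendsto (fun i => (α i + β i)⁻¹ / ((x₀ - m) / 2) ^ 2) l (nhds 0) := by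
    simpa using hαβ.inv_tendsto_atTop.div_const (((x₀ - m) / 2) ^ 2)
  have hdist := (hx₀.sub hm).eventually_const_lt (show (x₀ - m) / 2 < x₀ - m by linarith)
  suffices hs : Tendsto (fun i => 1 - betaCdf (α i) (β i) (x i)) l (nhds 0) by
    simpa using hs.const_sub 1
  refine tendsto_of_tendsto_of_tendsto_of_le_of_le' tendsto_const_nhds hlim ?_ ?_
  · filter_upwards [hα, hβ, hx] with i h1 h2 h3
    rw [one_sub_betaCdf h1 h2]
    refine mul_nonneg (inv_nonneg.2
      (ProbabilityTheory.beta_pos (by linarith) (by linarith)).le)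
      (intervalIntegral.integral_nonneg h3.2 fun u hu => ?_)
    exact mul_nonneg (Real.rpow_nonneg (h3.1.trans hu.1) _)
      (Real.rpow_nonneg (sub_nonneg.2 hu.2) _)
  · filter_upwards [hα, hβ, hx, hdist] with i h1 h2 h3 h4
    rw [one_sub_betaCdf h1 h2]
    refine integral_le_of_dist_mean_le h1 h2 h3.1 h3.2 le_rfl (by linarith) fun u hu => ?_
    exact pow_le_pow_left₀ (by linarith) (by linarith [hu.1]) 2

/-- The coefficients of the truncated sum `qS`. -/
def qCoeff (n L : ℝ) (k : ℕ) : ℝ :=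
  Real.Gamma (L + n + 1) / (Real.Gamma ((k : ℝ) + L + 1) * Real.Gamma (n + 1 - k))

lemma mul_inv_Gamma_add_one (s : ℝ) : s * (Real.Gamma (s + 1))⁻¹ = (Real.Gamma s)⁻¹ := by
  rcases eq_or_ne s 0 with rfl | hs
  · simp
  · rw [Real.Gamma_add_one hs, mul_inv, mul_inv_cancel_left₀ hs]

lemma mul_qCoeff_left (n L : ℝ) (k : ℕ) :
    (k + L) * qCoeff n L k = (ProbabilityTheory.beta (L + k) (n + 1 - k))⁻¹ := by
  rw [qCoeff, ProbabilityTheory.beta, add_comm L (k : ℝ),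
    show (k : ℝ) + L + (n + 1 - k) = L + n + 1 by ring, inv_div, div_eq_mul_inv, div_eq_mul_inv,
    mul_inv, mul_inv, ← mul_inv_Gamma_add_one (k + L)]
  ring

lemma mul_qCoeff_right (n L : ℝ) (k : ℕ) :
    (n - k) * qCoeff n L k =
      (ProbabilityTheory.beta (L + (k + 1 : ℕ)) (n + 1 - (k + 1 : ℕ)))⁻¹ := by
  rw [qCoeff, ProbabilityTheory.beta,
    show L + ((k + 1 : ℕ) : ℝ) + (n + 1 - (k + 1 : ℕ)) = L + n + 1 by ring, inv_div,
    div_eq_mul_inv, div_eq_mul_inv, mul_inv, mul_inv,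
    show n + 1 - ((k + 1 : ℕ) : ℝ) = n - k by push_cast; ring, ← mul_inv_Gamma_add_one (n - k),
    show L + ((k + 1 : ℕ) : ℝ) = k + L + 1 by push_cast; ring,
    show n - (k : ℝ) + 1 = n + 1 - k by ring]
  ring

/-- The derivative of the truncated binomial sum telescopes. -/
lemma hasDerivAt_sum_qCoeff (n L : ℝ) (K : ℕ) {x : ℝ} (hx : 0 < x) (hx1 : x < 1) :
    HasDerivAt (fun x : ℝ => ∑ k ∈ range K, qCoeff n L k * (x ^ (k + L) * (1 - x) ^ (n - k)))
      ((ProbabilityTheory.beta L (n + 1))⁻¹ * (x ^ (L - 1) * (1 - x) ^ (n + 1 - 1)) -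
        (ProbabilityTheory.beta (L + K) (n + 1 - K))⁻¹ *
          (x ^ (L + K - 1) * (1 - x) ^ (n + 1 - K - 1))) x := by
  induction K with
  | zero => simpa using hasDerivAt_const x (0 : ℝ)
  | succ K ih =>
    simp only [sum_range_succ]
    have h1 : HasDerivAt (fun x : ℝ => x ^ (K + L)) ((K + L) * x ^ (K + L - 1)) x :=
      Real.hasDerivAt_rpow_const (Or.inl hx.ne')
    have h2 : HasDerivAt (fun x : ℝ => (1 - x) ^ (n - K))
        (-1 * (n - K) * (1 - x) ^ (n - K - 1)) x :=
      ((hasDerivAt_id x).const_sub 1).rpow_const (Or.inl (sub_pos.2 hx1).ne')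
    refine (ih.add ((h1.mul h2).const_mul (qCoeff n L K))).congr_deriv ?_
    rw [← mul_qCoeff_right, ← mul_qCoeff_left]
    rw [show n + 1 - (K : ℝ) - 1 = n - K by ring, show L + (K : ℝ) - 1 = K + L - 1 by ring,
      show L + ((K + 1 : ℕ) : ℝ) - 1 = K + L by push_cast; ring,
      show n + 1 - ((K + 1 : ℕ) : ℝ) - 1 = n - K - 1 by push_cast; ring]
    ring

lemma sum_qCoeff_eq {n L : ℝ} {K : ℕ} (hL : L = 0 ∨ 1 ≤ L) (hK : 1 ≤ K) (hKn : (K : ℝ) ≤ n)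
    {x : ℝ} (hx : 0 ≤ x) (hx1 : x ≤ 1) :
    ∑ k ∈ range K, qCoeff n L k * (x ^ (k + L) * (1 - x) ^ (n - k)) =
      ∑ k ∈ range K, qCoeff n L k * (0 : ℝ) ^ (k + L) +
        (betaCdf L (n + 1) x - betaCdf (L + K) (n + 1 - K) x) := by
  have hL0 : 0 ≤ L := by rcases hL with h | h <;> linarith
  have hK' : (1 : ℝ) ≤ K := by exact_mod_cast hK
  have hcont : Continuous
      fun x : ℝ => ∑ k ∈ range K, qCoeff n L k * (x ^ (k + L) * (1 - x) ^ (n - k)) := by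
    refine continuous_finsetSum _ fun k hk => continuous_const.mul
      (continuous_rpow_mul_one_sub_rpow (by positivity) ?_)
    have : (k : ℝ) ≤ K := by exact_mod_cast (mem_range.1 hk).le
    linarith
  have hi1 : IntervalIntegrable (fun u : ℝ => (ProbabilityTheory.beta L (n + 1))⁻¹ *
      (u ^ (L - 1) * (1 - u) ^ (n + 1 - 1))) MeasureTheory.volume 0 x := by
    rcases hL with rfl | hL
    · simp [ProbabilityTheory.beta]
    · exact (continuous_const.mul (continuous_rpow_mul_one_sub_rpow (by linarith)
        (by linarith))).intervalIntegrable _ _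
  have hi2 : IntervalIntegrable (fun u : ℝ => (ProbabilityTheory.beta (L + K) (n + 1 - K))⁻¹ *
      (u ^ (L + K - 1) * (1 - u) ^ (n + 1 - K - 1))) MeasureTheory.volume 0 x :=
    (continuous_const.mul (continuous_rpow_mul_one_sub_rpow (by linarith)
        (by linarith))).intervalIntegrable _ _
  have hftc := intervalIntegral.integral_eq_sub_of_hasDerivAt_of_le hx hcont.continuousOn
    (fun u hu => hasDerivAt_sum_qCoeff n L K hu.1 (hu.2.trans_le hx1)) (hi1.sub hi2)
  rw [intervalIntegral.integral_sub hi1 hi2, intervalIntegral.integral_const_mul,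
    intervalIntegral.integral_const_mul] at hftc
  simp only [sub_zero, Real.one_rpow, mul_one] at hftc
  rw [betaCdf, betaCdf, hftc]
  ring

lemma sum_qCoeff_zero_rpow_of_pos {n L : ℝ} (K : ℕ) (hL : 0 < L) :
    ∑ k ∈ range K, qCoeff n L k * (0 : ℝ) ^ (k + L) = 0 :=
  sum_eq_zero fun k _ => by rw [Real.zero_rpow (by positivity), mul_zero]

lemma sum_qCoeff_zero_rpow_zero {n : ℝ} {K : ℕ} (hn : 0 ≤ n) (hK : 1 ≤ K) :
    ∑ k ∈ range K, qCoeff n 0 k * (0 : ℝ) ^ (k + (0 : ℝ)) = 1 := by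
  obtain ⟨K, rfl⟩ := Nat.exists_eq_add_of_le' hK
  rw [sum_range_succ', sum_eq_zero fun k _ => ?_]
  · have : Real.Gamma (n + 1) ≠ 0 := (Real.Gamma_pos_of_pos (by linarith)).ne'
    simp [qCoeff, this]
  · rw [Real.zero_rpow (by positivity), mul_zero]

lemma tendsto_affine_div_affine {c d : ℝ} (e f : ℝ) (hd : d ≠ 0) :
    Tendsto (fun N : ℕ => (c * N + e) / (d * N + f)) atTop (nhds (c / d)) := by
  have h0 : ∀ r : ℝ, Tendsto (fun N : ℕ => r / (N : ℝ)) atTop (nhds 0) := fun r =>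
    tendsto_const_nhds.div_atTop tendsto_natCast_atTop_atTop
  have h : Tendsto (fun N : ℕ => (c + e / N) / (d + f / N)) atTop (nhds (c / d)) := by
    have h := ((h0 e).const_add c).div ((h0 f).const_add d) (by simpa using hd)
    rwa [add_zero, add_zero] at h
  refine h.congr' ?_
  filter_upwards [eventually_ne_atTop 0] with N hN
  have hN' : (N : ℝ) ≠ 0 := by exact_mod_cast hN
  rw [← mul_div_mul_right (c + e / N) _ hN', add_mul, add_mul, div_mul_cancel₀ _ hN',
    div_mul_cancel₀ _ hN']

lemma tendsto_affine_atTop {c : ℝ} (d : ℝ) (hc : 0 < c) :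
    Tendsto (fun N : ℕ => c * N + d) atTop atTop :=
  tendsto_atTop_add_const_right _ _ (tendsto_natCast_atTop_atTop.const_mul_atTop hc)

section BulkLimit

variable {a b x₀ : ℝ} {x : ℕ → ℝ}

lemma tendsto_betaCdf_left (ha : 0 < a) (hb : 0 < b) (hx : Tendsto x atTop (nhds x₀))
    (h1 : a / (a + b + 1) < x₀) (hx1 : x₀ < 1) :
    Tendsto (fun N : ℕ => betaCdf (a * N) ((b + 1) * N + 1) (x N)) atTop (nhds 1) := by
  have hx0 : 0 < x₀ := lt_of_le_of_lt (by positivity) h1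
  refine tendsto_betaCdf_one
    (by simpa using (tendsto_affine_atTop 0 ha).eventually_ge_atTop 1)
    ((tendsto_affine_atTop 1 (by linarith)).eventually_ge_atTop 1)
    (hx.eventually (Icc_mem_nhds hx0 hx1)) ?_ ?_ hx h1
  · refine (tendsto_affine_atTop 1 (by linarith : 0 < a + b + 1)).congr fun N => ?_
    ring
  · refine (tendsto_affine_div_affine (c := a) 0 1 (by linarith : a + b + 1 ≠ 0)).congr fun N => ?_
    congr 1 <;> ring

/-- The truncated binomial sum captures the full mass in the bulk. -/
lemma tendsto_sum_qCoeff (ha : 0 ≤ a) (hb : 0 < b) (hx : Tendsto x atTop (nhds x₀))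
    (h1 : a / (a + b + 1) < x₀) (h2 : x₀ < (a + 1) / (a + b + 1)) :
    Tendsto (fun N : ℕ => ∑ k ∈ range N, qCoeff ((b + 1) * N) (a * N) k *
      (x N ^ (k + a * N) * (1 - x N) ^ ((b + 1) * N - k))) atTop (nhds 1) := by
  have hx0 : 0 < x₀ := lt_of_le_of_lt (by positivity) h1
  have hx1 : x₀ < 1 := h2.trans ((div_lt_one (by linarith)).2 (by linarith))
  have hmem := hx.eventually (Icc_mem_nhds hx0 hx1)
  have hright : Tendsto (fun N : ℕ => betaCdf (a * N + N) ((b + 1) * N + 1 - N) (x N))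
      atTop (nhds 0) := by
    refine tendsto_betaCdf_zero ?_ ?_ hmem ?_ ?_ hx h2
    · filter_upwards [(tendsto_affine_atTop 0 (by linarith : 0 < a + 1)).eventually_ge_atTop 1]
        with N hN
      linarith
    · filter_upwards with N
      linarith [mul_nonneg hb.le N.cast_nonneg]
    · refine (tendsto_affine_atTop 1 (by linarith : 0 < a + b + 1)).congr fun N => ?_
      ring
    · refine (tendsto_affine_div_affine (c := a + 1) 0 1
        (by linarith : a + b + 1 ≠ 0)).congr fun N => ?_
      congr 1 <;> ring
  have hKn : ∀ N : ℕ, (N : ℝ) ≤ (b + 1) * N := fun N => by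
    linarith [mul_nonneg hb.le (N.cast_nonneg : (0 : ℝ) ≤ N)]
  rcases ha.eq_or_lt with rfl | ha
  · have h := hright.const_sub 1
    rw [sub_zero] at h
    refine h.congr' ?_
    filter_upwards [hmem, eventually_ge_atTop 1] with N hN hN1
    simp only [zero_mul]
    rw [sum_qCoeff_eq (Or.inl rfl) hN1 (hKn N) hN.1 hN.2,
      sum_qCoeff_zero_rpow_zero (by positivity) hN1]
    simp [betaCdf, ProbabilityTheory.beta, sub_eq_add_neg]
  · have h := (tendsto_betaCdf_left ha hb hx h1 hx1).sub hright
    rw [sub_zero] at h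
    refine h.congr' ?_
    filter_upwards [hmem, eventually_ge_atTop 1,
      (tendsto_affine_atTop 0 ha).eventually_ge_atTop 1] with N hN hN1 hN2
    rw [add_zero] at hN2
    rw [sum_qCoeff_eq (Or.inr hN2) hN1 (hKn N) hN.1 hN.2,
      sum_qCoeff_zero_rpow_of_pos _ (by linarith), zero_add]

/-- The first term of the truncated binomial sum is negligible in the bulk. -/
lemma tendsto_qCoeff_zero_mul (ha : 0 < a) (hb : 0 < b) (hx : Tendsto x atTop (nhds x₀))
    (h1 : a / (a + b + 1) < x₀) (hx1 : x₀ < 1) :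
    Tendsto (fun N : ℕ => qCoeff ((b + 1) * N) (a * N) 0 *
      (x N ^ (a * N) * (1 - x N) ^ ((b + 1) * N))) atTop (nhds 0) := by
  have hx0 : 0 < x₀ := lt_of_le_of_lt (by positivity) h1
  have hmem := hx.eventually (Icc_mem_nhds hx0 hx1)
  have hn := (tendsto_affine_atTop 0 (by linarith : 0 < b + 1)).eventually_ge_atTop 1
  have hright : Tendsto (fun N : ℕ => betaCdf (a * N + 1) ((b + 1) * N + 1 - 1) (x N))
      atTop (nhds 1) := by
    refine tendsto_betaCdf_one ((tendsto_affine_atTop 1 ha).eventually_ge_atTop 1) ?_ hmem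
      ?_ ?_ hx h1
    · filter_upwards [hn] with N hN
      linarith
    · refine (tendsto_affine_atTop 1 (by linarith : 0 < a + b + 1)).congr fun N => ?_
      ring
    · refine (tendsto_affine_div_affine (c := a) 1 1
        (by linarith : a + b + 1 ≠ 0)).congr fun N => ?_
      congr 1
      ring
  have h := (tendsto_betaCdf_left ha hb hx h1 hx1).sub hright
  rw [sub_self] at h
  refine h.congr' ?_
  filter_upwards [hmem, hn, (tendsto_affine_atTop 0 ha).eventually_ge_atTop 1] with N hN hN1 hN2
  rw [add_zero] at hN1 hN2
  have hs := sum_qCoeff_eq (n := (b + 1) * N) (Or.inr hN2) le_rfl (by simpa using hN1) hN.1 hN.2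
  rw [sum_qCoeff_zero_rpow_of_pos _ (by linarith)] at hs
  simpa using hs.symm

end BulkLimit

lemma tendsto_one_add_mul_rpow_mul_rpow {c p v : ℝ} {z w : ℕ → ℝ}
    (hz : Tendsto z atTop (nhds p)) (hw : Tendsto w atTop (nhds p))
    (hv : Tendsto (fun N : ℕ => N * (z N - w N) ^ 2) atTop (nhds v)) :
    Tendsto (fun N : ℕ => (1 + z N * w N) ^ (c * N) *
        ((1 + z N ^ 2) * (1 + w N ^ 2)) ^ (-(c * N + 1) / 2))
      atTop (nhds (Real.exp (-(c * (v / (1 + p ^ 2) ^ 2)) / 2) / (1 + p ^ 2))) := by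
  have hp : 0 < 1 + p ^ 2 := by positivity
  have hy : Tendsto (fun N => 1 + z N * w N) atTop (nhds (1 + p ^ 2)) := by
    simpa [sq] using (hz.mul hw).const_add 1
  have hpow : Tendsto (fun N : ℕ => (1 + (z N - w N) ^ 2 / (1 + z N * w N) ^ 2) ^ N) atTop
      (nhds (Real.exp (v / (1 + p ^ 2) ^ 2))) := by
    refine Real.tendsto_one_add_pow_exp_of_tendsto ?_
    exact (hv.div (hy.pow 2) (by positivity)).congr fun N => mul_div_assoc _ _ _
  have hexp : Tendsto (fun N : ℕ => ((-c) * N + (-1)) / (2 * N + 0)) atTop (nhds (-c / 2)) :=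
    tendsto_affine_div_affine (-1) 0 two_ne_zero
  have h := (hpow.rpow hexp (Or.inl (Real.exp_ne_zero _))).mul (hy.inv₀ hp.ne')
  rw [← Real.exp_mul, ← div_eq_mul_inv,
    show v / (1 + p ^ 2) ^ 2 * (-c / 2) = -(c * (v / (1 + p ^ 2) ^ 2)) / 2 by ring] at h
  refine h.congr' ?_
  filter_upwards [hy.eventually_const_lt hp, eventually_ne_atTop 0] with N hN hN0
  have hN' : (N : ℝ) ≠ 0 := by exact_mod_cast hN0
  set y := 1 + z N * w N with hydef
  have hg : 0 < 1 + (z N - w N) ^ 2 / y ^ 2 := by positivity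
  have hW : (1 + z N ^ 2) * (1 + w N ^ 2) = y ^ 2 * (1 + (z N - w N) ^ 2 / y ^ 2) := by
    rw [mul_add (y ^ 2), mul_div_cancel₀ _ (by positivity), hydef]
    ring
  rw [hW, Real.mul_rpow (by positivity) hg.le]
  generalize 1 + (z N - w N) ^ 2 / y ^ 2 = g at hg
  rw [← Real.rpow_natCast y 2, ← Real.rpow_mul hN.le, ← Real.rpow_natCast g N,
    ← Real.rpow_mul hg.le, ← mul_assoc, ← Real.rpow_add hN, mul_comm]
  congr 2
  · rw [← Real.rpow_neg_one]
    congr 1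
    push_cast
    ring
  · field_simp
    ring

lemma pow_mul_rpow_mul_rpow_neg {n L y : ℝ} (k : ℕ) (hy : 0 < y) :
    y ^ k * (y ^ L * (1 + y) ^ (-(n + L))) =
      (y / (1 + y)) ^ (k + L) * (1 - y / (1 + y)) ^ (n - k) := by
  have h1 : 0 < 1 + y := by linarith
  rw [show 1 - y / (1 + y) = (1 + y)⁻¹ by field_simp; ring, Real.inv_rpow h1.le,
    Real.div_rpow hy.le h1.le, ← Real.rpow_neg h1.le, ← Real.rpow_natCast, Real.rpow_add hy,
    div_eq_mul_inv, ← Real.rpow_neg h1.le,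
    show -(n + L) = -(k + L) + -(n - k) by ring, Real.rpow_add h1]
  ring

lemma qS_mul_rpow {n L y : ℝ} {N : ℕ} (hN : 1 ≤ N) (hy : 0 < y) :
    qS n L (N - 1) y * (y ^ L * (1 + y) ^ (-(n + L))) =
      ∑ k ∈ range N, qCoeff n L k *
        ((y / (1 + y)) ^ (k + L) * (1 - y / (1 + y)) ^ (n - k)) := by
  rw [qS, Nat.sub_add_cancel hN, sum_mul]
  refine sum_congr rfl fun k _ => ?_
  rw [mul_assoc, pow_mul_rpow_mul_rpow_neg k hy, qCoeff]

lemma mul_qCoeff_zero (n L : ℝ) :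
    L * qCoeff n L 0 = Real.Gamma (L + n + 1) / (Real.Gamma (n + 1) * Real.Gamma L) := by
  have h := mul_qCoeff_left n L 0
  simp only [Nat.cast_zero, zero_add, add_zero, sub_zero] at h
  rw [h, ProbabilityTheory.beta, inv_div, add_assoc, mul_comm (Real.Gamma L)]

/-- Bulk scaling limit, in the strongly non-unitary regime, of the weighted truncated
sum `q̂ · ω̂` arising from the induced spherical unitary ensemble. -/
theorem qhat_bulk_limit (a b : ℝ) (ha : 0 ≤ a) (hb : 0 < b)
    (p : ℝ) (hp : 0 < p) (hp1 : a / (b + 1) < p ^ 2) (hp2 : p ^ 2 < (a + 1) / b)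
    (s t χ : ℝ) :
    Tendsto (fun N : ℕ =>
      let LN : ℝ := a * N
      let nN : ℝ := (b + 1) * N
      let δN : ℝ := (nN + LN + 1) / (N * (1 + p ^ 2) ^ 2)
      let zN : ℝ := p + s / Real.sqrt (N * δN)
      let wN : ℝ := p + t / Real.sqrt (N * δN)
      let lamN : ℝ := p + χ / Real.sqrt (N * δN)
      qhat nN LN (N - 1) (zN * wN) (lamN ^ 2) * (zN * wN) ^ LN *
        ((1 + zN ^ 2) * (1 + wN ^ 2)) ^ (-(nN + LN + 1) / 2))
      atTop
      (nhds (Real.exp (-(s - t) ^ 2 / 2) / (1 + p ^ 2))) := by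
  have hq : 0 < 1 + p ^ 2 := by positivity
  have hc : 0 < a + b + 1 := by linarith
  set r : ℕ → ℝ := fun N =>
    Real.sqrt (N * (((b + 1) * N + a * N + 1) / (N * (1 + p ^ 2) ^ 2))) with hr
  have hr2 : ∀ᶠ N : ℕ in atTop, r N ^ 2 = ((a + b + 1) * N + 1) / (1 + p ^ 2) ^ 2 := by
    filter_upwards [eventually_ne_atTop 0] with N hN
    have hN' : (N : ℝ) ≠ 0 := by exact_mod_cast hN
    rw [hr, Real.sq_sqrt (by positivity)]
    field_simp
    ring
  have hrtop : Tendsto r atTop atTop := by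
    have h : Tendsto (fun N => r N ^ 2) atTop atTop :=
      ((tendsto_affine_atTop 1 hc).atTop_div_const (by positivity : 0 < (1 + p ^ 2) ^ 2)).congr'
        (hr2.mono fun N hN => hN.symm)
    refine (Real.tendsto_sqrt_atTop.comp h).congr fun N => Real.sqrt_sq (Real.sqrt_nonneg _)
  have hlim : ∀ σ : ℝ, Tendsto (fun N => p + σ / r N) atTop (nhds p) := fun σ => by
    simpa using (tendsto_const_nhds.div_atTop hrtop).const_add p
  have hy : Tendsto (fun N => (p + s / r N) * (p + t / r N)) atTop (nhds (p ^ 2)) := by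
    simpa [sq] using (hlim s).mul (hlim t)
  have hx : Tendsto (fun N => (p + s / r N) * (p + t / r N) /
      (1 + (p + s / r N) * (p + t / r N))) atTop (nhds (p ^ 2 / (1 + p ^ 2))) :=
    hy.div (hy.const_add 1) hq.ne'
  rw [div_lt_iff₀ (by linarith)] at hp1
  rw [lt_div_iff₀ hb] at hp2
  have hx1 : a / (a + b + 1) < p ^ 2 / (1 + p ^ 2) := by
    rw [div_lt_div_iff₀ hc hq]
    linarith
  have hx2 : p ^ 2 / (1 + p ^ 2) < (a + 1) / (a + b + 1) := by
    rw [div_lt_div_iff₀ hq hc]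
    linarith
  have hx3 : p ^ 2 / (1 + p ^ 2) < 1 := (div_lt_one hq).2 (by linarith)
  have hsum := tendsto_sum_qCoeff ha hb hx hx1 hx2
  have hcorr : Tendsto (fun N : ℕ => a / ((b + 1) * (p + χ / r N) ^ 2 - a) *
      (qCoeff ((b + 1) * N) (a * N) 0 *
        (((p + s / r N) * (p + t / r N) / (1 + (p + s / r N) * (p + t / r N))) ^ (a * N) *
        (1 - (p + s / r N) * (p + t / r N) / (1 + (p + s / r N) * (p + t / r N))) ^
          ((b + 1) * N)))) atTop (nhds 0) := by
    rcases ha.eq_or_lt with rfl | ha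
    · simp
    · have h := ((tendsto_const_nhds (x := a)).div ((((hlim χ).pow 2).const_mul (b + 1)).sub_const a)
        (by linarith)).mul (tendsto_qCoeff_zero_mul ha hb hx hx1 hx3)
      rwa [mul_zero] at h
  have hv : Tendsto (fun N : ℕ => N * ((p + s / r N) - (p + t / r N)) ^ 2) atTop
      (nhds ((s - t) ^ 2 * (1 + p ^ 2) ^ 2 * (1 / (a + b + 1)))) := by
    refine ((tendsto_affine_div_affine (c := 1) 0 1 hc.ne').const_mul
      ((s - t) ^ 2 * (1 + p ^ 2) ^ 2)).congr' ?_
    filter_upwards [hr2] with N hN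
    rw [show p + s / r N - (p + t / r N) = (s - t) / r N by ring, div_pow, hN]
    field_simp
    ring
  have hweight := tendsto_one_add_mul_rpow_mul_rpow (c := a + b + 1) (hlim s) (hlim t) hv
  have h := (hsum.add hcorr).mul hweight
  rw [add_zero, one_mul, show -((a + b + 1) * ((s - t) ^ 2 * (1 + p ^ 2) ^ 2 * (1 / (a + b + 1)) /
    (1 + p ^ 2) ^ 2)) / 2 = -(s - t) ^ 2 / 2 by field_simp] at h
  refine h.congr' ?_
  filter_upwards [eventually_ge_atTop 1, hy.eventually_const_lt (by positivity : 0 < p ^ 2)]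
    with N hN hyN
  have hN' : (N : ℝ) ≠ 0 := by
    have : N ≠ 0 := by lia
    exact_mod_cast this
  change _ = qhat ((b + 1) * N) (a * N) (N - 1) ((p + s / r N) * (p + t / r N))
      ((p + χ / r N) ^ 2) * ((p + s / r N) * (p + t / r N)) ^ (a * N) *
    ((1 + (p + s / r N) ^ 2) * (1 + (p + t / r N) ^ 2)) ^ (-((b + 1) * N + a * N + 1) / 2)
  set y := (p + s / r N) * (p + t / r N) with hydef
  have hy1 : 0 < 1 + y := by linarith
  have hfrac : a / ((b + 1) * (p + χ / r N) ^ 2 - a) =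
      1 / ((b + 1) * N * (p + χ / r N) ^ 2 - a * N) * (a * N) := by
    rw [← mul_div_mul_right a _ hN']
    ring
  have hterm := pow_mul_rpow_mul_rpow_neg (n := (b + 1) * N) (L := a * N) 0 hyN
  simp only [pow_zero, one_mul, Nat.cast_zero, zero_add, sub_zero] at hterm
  rw [← qS_mul_rpow hN hyN, ← hterm, hfrac, qhat, ← mul_qCoeff_zero,
    show (b + 1) * (N : ℝ) + a * N = (a + b + 1) * N by ring, Real.rpow_neg hy1.le]
  have hne : (1 + y) ^ ((a + b + 1) * N) ≠ 0 := (Real.rpow_pos_of_pos hy1 _).ne'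
  generalize 1 / ((b + 1) * N * (p + χ / r N) ^ 2 - a * N) = C
  generalize (1 + y) ^ ((a + b + 1) * N) = E at hne ⊢
  field_simp
end
end
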